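/- arXiv:1403.6986 — 12 statements merged into one kernel-verified Lean document; each statement's English description precedes it below -/
import Mathlib

section
/- A nonempty set A ⊆ ℝ is compact in the |·|_a-topology if and only if A is bounded above and sup A ∈ A (i.e., A contains its supremum). -/
open Set Pointwise

/-- The topology on `X` induced by the asymmetric "norm" `q`:
`U` is open iff around each of its points it contains a forward ball `{y | q (y - x) < ε}`. -/
def ballTop {X : Type*} [Sub X] (q : X → ℝ) : TopologicalSpace X where
  IsOpen U := ∀ x ∈ U, ∃ ε > 0, ∀ y, q (y - x) < ε → y ∈ U
  isOpen_univ := fun _ _ => ⟨1, one_pos, fun _ _ => trivial⟩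
  isOpen_inter := fun U V hU hV x hx => by
    obtain ⟨ε₁, hε₁, h₁⟩ := hU x hx.1
    obtain ⟨ε₂, hε₂, h₂⟩ := hV x hx.2
    exact ⟨min ε₁ ε₂, lt_min hε₁ hε₂, fun y hy =>
      ⟨h₁ y (hy.trans_le (min_le_left _ _)), h₂ y (hy.trans_le (min_le_right _ _))⟩⟩
  isOpen_sUnion := fun S hS x hx => by
    obtain ⟨U, hUS, hxU⟩ := hx
    obtain ⟨ε, hε, h⟩ := hS U hUS x hxU
    exact ⟨ε, hε, fun y hy => ⟨U, hUS, h y hy⟩⟩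

theorem isOpen_ballTop_Iio (a : ℝ) :
    @IsOpen ℝ (ballTop (fun r : ℝ => max r 0)) (Iio a) := by
  intro x (hx : x < a)
  refine ⟨a - x, sub_pos.2 hx, fun y hy => ?_⟩
  have h : y - x < a - x := (le_max_left _ _).trans_lt hy
  exact sub_lt_sub_iff_right x |>.1 h

theorem isLowerSet_of_isOpen_ballTop {U : Set ℝ}
    (hU : @IsOpen ℝ (ballTop (fun r : ℝ => max r 0)) U) : IsLowerSet U := by
  intro x y hyx hx
  obtain ⟨ε, hε, h⟩ := hU x hx
  exact h y (max_lt ((sub_nonpos.2 hyx).trans_lt hε) hε)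

theorem exists_isGreatest_of_isCompact_ballTop {A : Set ℝ} (hA : A.Nonempty)
    (hc : @IsCompact ℝ (ballTop (fun r : ℝ => max r 0)) A) : ∃ a, IsGreatest A a := by
  by_contra! hmax
  have : Nonempty A := hA.to_subtype
  have hcover : A ⊆ ⋃ a : A, Iio (a : ℝ) := by
    intro x hx
    by_contra hn
    refine hmax x ⟨hx, fun y hy => not_lt.1 fun hxy => hn ?_⟩
    exact mem_iUnion.2 ⟨⟨y, hy⟩, hxy⟩
  have hdir : Directed (· ⊆ ·) fun a : A => Iio (a : ℝ) :=
    Monotone.directed_le fun _ _ hab => Iio_subset_Iio hab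
  obtain ⟨a, ha⟩ := @IsCompact.elim_directed_cover ℝ (ballTop (fun r : ℝ => max r 0)) A A _ hc
    (fun a => Iio (a : ℝ)) (fun a => isOpen_ballTop_Iio a) hcover hdir
  exact lt_irrefl (a : ℝ) (ha a.2)

theorem isCompact_ballTop_of_isGreatest {A : Set ℝ} {a : ℝ} (ha : IsGreatest A a) :
    @IsCompact ℝ (ballTop (fun r : ℝ => max r 0)) A := by
  refine @isCompact_of_finite_subcover ℝ (ballTop (fun r : ℝ => max r 0)) A ?_
  intro ι U hU hcover
  obtain ⟨i, hi⟩ := mem_iUnion.1 (hcover ha.1)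
  refine ⟨{i}, fun x hx => ?_⟩
  simpa using isLowerSet_of_isOpen_ballTop (hU i) (ha.2 hx) hi

/-- A nonempty set `A ⊆ ℝ` is compact in the topology of the asymmetric norm
`|r|_a = max r 0` iff it is bounded above and contains its supremum. -/
theorem aCompact_iff_bddAbove_sSup_mem (A : Set ℝ) (hA : A.Nonempty) :
    @IsCompact ℝ (ballTop (fun r : ℝ => max r 0)) A ↔ BddAbove A ∧ sSup A ∈ A := by
  constructor
  · intro hc
    obtain ⟨a, ha⟩ := exists_isGreatest_of_isCompact_ballTop hA hc
    exact ⟨ha.bddAbove, ha.csSup_mem⟩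
  · rintro ⟨hb, hm⟩
    exact isCompact_ballTop_of_isGreatest ⟨hm, fun _ hx => le_csSup hb hx⟩
end

section
/- Let K ⊆ ℝ² be a nonempty q-compact convex set. Then the suprema u, v, α, β are finite (in particular the sets {x₁ : (x₁,v) ∈ K} and {x₂ : (u,x₂) ∈ K} are nonempty), and both points (u, β) and (α, v) belong to K. -/
open Set Pointwise

/-- The asymmetric lattice norm on `ℝ²` induced by a lattice norm `N`: `q x = N (x ∨ 0)`. -/
def q2 (N : ℝ × ℝ → ℝ) : ℝ × ℝ → ℝ := fun x => N (max x.1 0, max x.2 0)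

/-- `θ₀ = {x | q x = 0}`. -/
def theta0 (N : ℝ × ℝ → ℝ) : Set (ℝ × ℝ) := {x | q2 N x = 0}

/-- Translate of a set of `ℝ²` by a vector. -/
def transl (a : ℝ × ℝ) (S : Set (ℝ × ℝ)) : Set (ℝ × ℝ) := (a + ·) '' S

/-- The interior of `θ₀` with respect to the `q`-topology. -/
def thetaIntQ (N : ℝ × ℝ → ℝ) : Set (ℝ × ℝ) :=
  @interior _ (ballTop (q2 N)) (theta0 N)

/-- On a nonempty compact set, a pair of upper semicontinuous functions has a lexicographic
maximum. -/
theorem IsCompact.exists_lex_max {X : Type*} [TopologicalSpace X] {K : Set X} (hK : IsCompact K)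
    (hne : K.Nonempty) {f g : X → ℝ} (hf : UpperSemicontinuous f) (hg : UpperSemicontinuous g) :
    ∃ p ∈ K, (∀ y ∈ K, f y ≤ f p) ∧ ∀ y ∈ K, f y = f p → g y ≤ g p := by
  obtain ⟨x, hxK, hx⟩ := (hf.upperSemicontinuousOn K).exists_isMaxOn hne hK
  have hcl : IsClosed (f ⁻¹' Ici (f x)) := hf.isClosed_preimage (f x)
  obtain ⟨p, ⟨hpK, hpx⟩, hp⟩ :=
    (hg.upperSemicontinuousOn _).exists_isMaxOn
      (s := K ∩ f ⁻¹' Ici (f x)) ⟨x, hxK, le_refl (f x)⟩ (hK.inter_right hcl)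
  have hpx : f x ≤ f p := hpx
  exact ⟨p, hpK, fun y hy => (hx hy).trans hpx,
    fun y hy hyp => hp ⟨hy, show f x ≤ f y from hyp ▸ hpx⟩⟩

/-- A coordinate functional whose positive part is controlled by `q` is upper semicontinuous in
the `q`-topology. -/
theorem upperSemicontinuous_ballTop {X : Type*} [Sub X] {q : X → ℝ} {f : X → ℝ} {m : ℝ}
    (hm : 0 < m) (h : ∀ x y, (f y - f x) * m ≤ q (y - x)) :
    @UpperSemicontinuous _ _ (ballTop q) _ f := by
  let _ := ballTop q
  refine upperSemicontinuous_iff_isOpen_preimage.2 fun c x hx => ?_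
  have hx : f x < c := hx
  refine ⟨(c - f x) * m, mul_pos (sub_pos.2 hx) hm, fun y hy => ?_⟩
  have := lt_of_mul_lt_mul_right ((h x y).trans_lt hy) hm.le
  show f y < c
  linarith

/-- For a nonempty `q`-compact convex set `K ⊆ ℝ²`, the suprema `u, v, α, β` are finite
(the relevant sets are nonempty and bounded above) and `(u, β), (α, v) ∈ K`. -/
theorem corner_points_mem
    (N : ℝ × ℝ → ℝ)
    (hN0 : ∀ x : ℝ × ℝ, N x = 0 ↔ x = 0)
    (hNs : ∀ (c : ℝ) (x : ℝ × ℝ), N (c • x) = |c| * N x)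
    (hNt : ∀ x y : ℝ × ℝ, N (x + y) ≤ N x + N y)
    (hNl : ∀ x y : ℝ × ℝ, |x.1| ≤ |y.1| → |x.2| ≤ |y.2| → N x ≤ N y)
    (K : Set (ℝ × ℝ)) (hne : K.Nonempty) (hconv : Convex ℝ K)
    (hcomp : @IsCompact _ (ballTop (q2 N)) K)
    (u v a b : ℝ)
    (hu : u = sSup (Prod.fst '' K)) (hv : v = sSup (Prod.snd '' K))
    (ha : a = sSup {x : ℝ | (x, v) ∈ K}) (hb : b = sSup {y : ℝ | (u, y) ∈ K}) :
    BddAbove (Prod.fst '' K) ∧ BddAbove (Prod.snd '' K) ∧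
    {x : ℝ | (x, v) ∈ K}.Nonempty ∧ {y : ℝ | (u, y) ∈ K}.Nonempty ∧
    BddAbove {x : ℝ | (x, v) ∈ K} ∧ BddAbove {y : ℝ | (u, y) ∈ K} ∧
    (u, b) ∈ K ∧ (a, v) ∈ K := by
  have hpos : ∀ x, x ≠ 0 → 0 < N x := fun x hx => by
    have h0 := hNl 0 x (by simp) (by simp)
    rw [(hN0 0).2 rfl] at h0
    exact h0.lt_of_ne fun h => hx ((hN0 x).1 h.symm)
  have hfst : @UpperSemicontinuous _ _ (ballTop (q2 N)) _ (Prod.fst : ℝ × ℝ → ℝ) := by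
    have hm : 0 < N (1, 0) := hpos _ (by simp)
    refine upperSemicontinuous_ballTop hm fun x y => ?_
    calc (y.1 - x.1) * N (1, 0) ≤ |max (y.1 - x.1) 0| * N (1, 0) := by
          gcongr
          exact (le_max_left _ _).trans (le_abs_self _)
      _ = N (max (y.1 - x.1) 0 • (1, 0)) := (hNs _ _).symm
      _ ≤ q2 N (y - x) := hNl _ _ (by simp) (by simp)
  have hsnd : @UpperSemicontinuous _ _ (ballTop (q2 N)) _ (Prod.snd : ℝ × ℝ → ℝ) := by
    have hm : 0 < N (0, 1) := hpos _ (by simp)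
    refine upperSemicontinuous_ballTop hm fun x y => ?_
    calc (y.2 - x.2) * N (0, 1) ≤ |max (y.2 - x.2) 0| * N (0, 1) := by
          gcongr
          exact (le_max_left _ _).trans (le_abs_self _)
      _ = N (max (y.2 - x.2) 0 • (0, 1)) := (hNs _ _).symm
      _ ≤ q2 N (y - x) := hNl _ _ (by simp) (by simp)
  obtain ⟨⟨p₁, p₂⟩, hpK, hp, hp'⟩ :=
    @IsCompact.exists_lex_max _ (ballTop (q2 N)) _ hcomp hne _ _ hfst hsnd
  obtain ⟨⟨r₁, r₂⟩, hrK, hr, hr'⟩ :=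
    @IsCompact.exists_lex_max _ (ballTop (q2 N)) _ hcomp hne _ _ hsnd hfst
  have gu : IsGreatest (Prod.fst '' K) p₁ := ⟨⟨_, hpK, rfl⟩, forall_mem_image.2 hp⟩
  have gv : IsGreatest (Prod.snd '' K) r₂ := ⟨⟨_, hrK, rfl⟩, forall_mem_image.2 hr⟩
  rw [gu.csSup_eq] at hu
  rw [gv.csSup_eq] at hv
  subst u v
  have gb : IsGreatest {y : ℝ | (p₁, y) ∈ K} p₂ := ⟨hpK, fun y hy => hp' _ hy rfl⟩
  have ga : IsGreatest {x : ℝ | (x, r₂) ∈ K} r₁ := ⟨hrK, fun x hx => hr' _ hx rfl⟩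
  rw [gb.csSup_eq] at hb
  rw [ga.csSup_eq] at ha
  subst a b
  exact ⟨gu.bddAbove, gv.bddAbove, ga.nonempty, gb.nonempty, ga.bddAbove, gb.bddAbove, hpK, hrK⟩
end

section
/- Let K ⊆ ℝ² be a nonempty q-compact convex set with (α,v) ≠ (u,β). Then F_K ⊆ K. -/
open Set Pointwise

/-- A Euclidean-open lower set is open for the topology of the asymmetric lattice norm `q2 N`. -/
lemma isOpen_ballTop_q2_of_isLowerSet {N : ℝ × ℝ → ℝ}
    (hN0 : ∀ x : ℝ × ℝ, N x = 0 ↔ x = 0)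
    (hNl : ∀ x y : ℝ × ℝ, |x.1| ≤ |y.1| → |x.2| ≤ |y.2| → N x ≤ N y)
    {U : Set (ℝ × ℝ)} (hU : IsOpen U) (hlow : IsLowerSet U) :
    @IsOpen _ (ballTop (q2 N)) U := by
  have hpos : ∀ x : ℝ × ℝ, x ≠ 0 → 0 < N x := fun x hx => by
    have h := hNl 0 x (by simp) (by simp)
    rw [(hN0 0).2 rfl] at h
    exact lt_of_le_of_ne h fun h' => hx ((hN0 x).1 h'.symm)
  intro x hx
  obtain ⟨δ, hδ, hball⟩ := Metric.isOpen_iff.1 hU x hx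
  have hδ2 : 0 < δ / 2 := half_pos hδ
  have hmem : x + (δ / 2, δ / 2) ∈ U := hball <| by
    rw [mem_ball_iff_norm, add_sub_cancel_left, Prod.norm_mk, max_self, Real.norm_eq_abs,
      abs_of_pos hδ2]
    exact half_lt_self hδ
  refine ⟨min (N (δ / 2, 0)) (N (0, δ / 2)),
    lt_min (hpos _ fun h => hδ2.ne' (congrArg Prod.fst h))
      (hpos _ fun h => hδ2.ne' (congrArg Prod.snd h)), fun y hy => hlow ?_ hmem⟩
  obtain ⟨hy₁, hy₂⟩ := lt_min_iff.1 hy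
  refine ⟨?_, ?_⟩
  · by_contra! h
    refine hy₁.not_ge (hNl _ _ ?_ ?_)
    · have h' : δ / 2 ≤ (y - x).1 := by simp at h ⊢; linarith
      simpa [abs_of_pos hδ2] using (h'.trans (le_max_left _ 0)).trans (le_abs_self _)
    · simp
  · by_contra! h
    refine hy₂.not_ge (hNl _ _ ?_ ?_)
    · simp
    · have h' : δ / 2 ≤ (y - x).2 := by simp at h ⊢; linarith
      simpa [abs_of_pos hδ2] using (h'.trans (le_max_left _ 0)).trans (le_abs_self _)

/-- A continuous monotone function attains its maximum on a nonempty `q`-compact set. -/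
lemma exists_isMaxOn_of_isCompact_q2 {N : ℝ × ℝ → ℝ}
    (hN0 : ∀ x : ℝ × ℝ, N x = 0 ↔ x = 0)
    (hNl : ∀ x y : ℝ × ℝ, |x.1| ≤ |y.1| → |x.2| ≤ |y.2| → N x ≤ N y)
    {K : Set (ℝ × ℝ)} (hne : K.Nonempty) (hcomp : @IsCompact _ (ballTop (q2 N)) K)
    {f : ℝ × ℝ → ℝ} (hf : Continuous f) (hmono : Monotone f) :
    ∃ k ∈ K, ∀ y ∈ K, f y ≤ f k := by
  have husc : @UpperSemicontinuous _ _ (ballTop (q2 N)) _ f := by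
    refine (@upperSemicontinuous_iff_isOpen_preimage _ _ (ballTop (q2 N)) f _).2 fun c => ?_
    exact isOpen_ballTop_q2_of_isLowerSet hN0 hNl (isOpen_Iio.preimage hf)
      fun x y hyx hx => (hmono hyx).trans_lt hx
  exact @UpperSemicontinuousOn.exists_isMaxOn _ (ballTop (q2 N)) _ _ _ _ hne hcomp
    (@UpperSemicontinuous.upperSemicontinuousOn _ _ (ballTop (q2 N)) _ f husc K)

lemma exists_ge_of_mem_closure_of_isCompact_q2 {N : ℝ × ℝ → ℝ}
    (hN0 : ∀ x : ℝ × ℝ, N x = 0 ↔ x = 0)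
    (hNl : ∀ x y : ℝ × ℝ, |x.1| ≤ |y.1| → |x.2| ≤ |y.2| → N x ≤ N y)
    {K : Set (ℝ × ℝ)} (hne : K.Nonempty) (hcomp : @IsCompact _ (ballTop (q2 N)) K)
    {z : ℝ × ℝ} (hz : z ∈ closure K) : ∃ k ∈ K, z ≤ k := by
  have hf : Continuous fun y : ℝ × ℝ => min (y.1 - z.1) (y.2 - z.2) := by fun_prop
  obtain ⟨k, hk, hmax⟩ := exists_isMaxOn_of_isCompact_q2 hN0 hNl hne hcomp hf
    fun x y hxy => min_le_min (sub_le_sub_right hxy.1 _) (sub_le_sub_right hxy.2 _)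
  have h := closure_minimal hmax (isClosed_le hf continuous_const) hz
  replace h : min (z.1 - z.1) (z.2 - z.2) ≤ min (k.1 - z.1) (k.2 - z.2) := h
  simp only [sub_self, min_self, le_min_iff, sub_nonneg] at h
  exact ⟨k, hk, h⟩

/-- A point lying below `k` and on or above the line through `(u, b)` and `(a, v)` belongs to the
triangle with vertices `k`, `(u, b)` and `(a, v)`, provided `k ≤ (u, v)`. -/
lemma Convex.mem_of_le_of_above_line {K : Set (ℝ × ℝ)} (hconv : Convex ℝ K)
    {u v a b : ℝ} (hau : a < u) (hbv : b < v) (hP : ((u, b) : ℝ × ℝ) ∈ K)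
    (hQ : ((a, v) : ℝ × ℝ) ∈ K) {z k : ℝ × ℝ} (hk : k ∈ K) (hku : k.1 ≤ u) (hkv : k.2 ≤ v)
    (hzk : z ≤ k) (hz : (z.2 - b) * (a - u) ≤ (z.1 - u) * (v - b)) : z ∈ K := by
  obtain ⟨z₁, z₂⟩ := z
  obtain ⟨k₁, k₂⟩ := k
  obtain ⟨h₁, h₂⟩ := hzk
  dsimp only at *
  have hd : 0 < u - a := sub_pos.2 hau
  have he : 0 < v - b := sub_pos.2 hbv
  have m₁ : 0 ≤ (k₁ - z₁) * (v - b) := mul_nonneg (sub_nonneg.2 h₁) he.le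
  have m₂ : 0 ≤ (k₂ - z₂) * (u - a) := mul_nonneg (sub_nonneg.2 h₂) hd.le
  set lz := (z₁ - u) * (v - b) + (z₂ - b) * (u - a) with hlz
  set lk := (k₁ - u) * (v - b) + (k₂ - b) * (u - a) with hlk
  have hlz0 : 0 ≤ lz := by linarith
  have hle : lz ≤ lk := by linarith
  rcases (hlz0.trans hle).eq_or_lt with h0 | h0
  · have e₁ : z₁ = k₁ := by nlinarith
    have e₂ : z₂ = k₂ := by nlinarith
    rwa [e₁, e₂]
  · have ht0 : 0 ≤ lz / lk := div_nonneg hlz0 h0.le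
    have ht1 : lz / lk ≤ 1 := (div_le_one h0).2 hle
    have htl : lz / lk * lk = lz := div_mul_cancel₀ _ h0.ne'
    generalize lz / lk = t at ht0 ht1 htl
    have hm : 0 ≤ ((v - z₂) - t * (v - k₂)) / (v - b) :=
      div_nonneg (by nlinarith [mul_le_of_le_one_left (sub_nonneg.2 hkv) ht1]) he.le
    have hn : 0 ≤ ((u - z₁) - t * (u - k₁)) / (u - a) :=
      div_nonneg (by nlinarith [mul_le_of_le_one_left (sub_nonneg.2 hku) ht1]) hd.le
    have hm' : ((v - z₂) - t * (v - k₂)) / (v - b) * (v - b) = (v - z₂) - t * (v - k₂) :=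
      div_mul_cancel₀ _ he.ne'
    have hn' : ((u - z₁) - t * (u - k₁)) / (u - a) * (u - a) = (u - z₁) - t * (u - k₁) :=
      div_mul_cancel₀ _ hd.ne'
    generalize ((v - z₂) - t * (v - k₂)) / (v - b) = m at hm hm'
    generalize ((u - z₁) - t * (u - k₁)) / (u - a) = n at hn hn'
    have hsum : t + m + n = 1 := by
      refine mul_right_cancel₀ (mul_pos hd he).ne' ?_
      linear_combination (u - a) * hm' + (v - b) * hn' + htl + hlz - t * hlk
    have hmem := hconv.sum_mem (t := Finset.univ) (w := ![t, m, n])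
      (z := ![((k₁, k₂) : ℝ × ℝ), (u, b), (a, v)])
      (by simp [Fin.forall_fin_succ, ht0, hm, hn]) (by simpa [Fin.sum_univ_three] using hsum)
      (by simp [Fin.forall_fin_succ, hk, hP, hQ])
    convert hmem using 1
    simp only [Fin.sum_univ_three]
    ext
    · simp
      linear_combination -u * hsum + hn'
    · simp
      linear_combination -v * hsum + hm'

/-- `F_K ⊆ K` for a nonempty `q`-compact convex set `K ⊆ ℝ²` with `(α,v) ≠ (u,β)`.
Here `R_K = K ∩ H` with `H` the closed half-plane bounded by the line through `(u,β)`
and `(α,v)` containing `(u,v)`, and `F_K` is the Euclidean boundary of the closure of `R_K`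
minus the open segment `((u,β),(α,v))` if `R_K ≠ [(u,β),(α,v)]`, and `[(u,β),(α,v)]` otherwise. -/
theorem FK_subset
    (N : ℝ × ℝ → ℝ)
    (hN0 : ∀ x : ℝ × ℝ, N x = 0 ↔ x = 0)
    (hNs : ∀ (c : ℝ) (x : ℝ × ℝ), N (c • x) = |c| * N x)
    (hNt : ∀ x y : ℝ × ℝ, N (x + y) ≤ N x + N y)
    (hNl : ∀ x y : ℝ × ℝ, |x.1| ≤ |y.1| → |x.2| ≤ |y.2| → N x ≤ N y)
    (K : Set (ℝ × ℝ)) (hne : K.Nonempty) (hconv : Convex ℝ K)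
    (hcomp : @IsCompact _ (ballTop (q2 N)) K)
    (u v a b : ℝ)
    (hu : u = sSup (Prod.fst '' K)) (hv : v = sSup (Prod.snd '' K))
    (ha : a = sSup {x : ℝ | (x, v) ∈ K}) (hb : b = sSup {y : ℝ | (u, y) ∈ K})
    (hab : ((a, v) : ℝ × ℝ) ≠ (u, b))
    (R F : Set (ℝ × ℝ))
    (hR : R = K ∩ {p : ℝ × ℝ | (p.2 - b) * (a - u) ≤ (p.1 - u) * (v - b)})
    (hF : (R = segment ℝ ((u, b) : ℝ × ℝ) (a, v) ∧ F = segment ℝ ((u, b) : ℝ × ℝ) (a, v)) ∨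
          (R ≠ segment ℝ ((u, b) : ℝ × ℝ) (a, v) ∧
            F = frontier (closure R) \ openSegment ℝ ((u, b) : ℝ × ℝ) (a, v))) :
    F ⊆ K := by
  have hmax : ∀ {f : ℝ × ℝ → ℝ}, Continuous f → Monotone f → ∃ k ∈ K, ∀ y ∈ K, f y ≤ f k :=
    exists_isMaxOn_of_isCompact_q2 hN0 hNl hne hcomp
  have hge : ∀ {z : ℝ × ℝ}, z ∈ closure K → ∃ k ∈ K, z ≤ k :=
    exists_ge_of_mem_closure_of_isCompact_q2 hN0 hNl hne hcomp
  obtain ⟨p, hp, hpmax⟩ := hmax continuous_fst monotone_fst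
  obtain ⟨r, hr, hrmax⟩ := hmax continuous_snd monotone_snd
  have hpu : p.1 = u := by
    rw [hu]
    exact (IsGreatest.csSup_eq ⟨mem_image_of_mem _ hp, forall_mem_image.2 hpmax⟩).symm
  have hrv : r.2 = v := by
    rw [hv]
    exact (IsGreatest.csSup_eq ⟨mem_image_of_mem _ hr, forall_mem_image.2 hrmax⟩).symm
  rw [hpu] at hpmax
  rw [hrv] at hrmax
  have hbddv : BddAbove {x : ℝ | (x, v) ∈ K} := ⟨u, fun x hx => hpmax _ hx⟩
  have hbddu : BddAbove {y : ℝ | (u, y) ∈ K} := ⟨v, fun y hy => hrmax _ hy⟩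
  have hQ : (a, v) ∈ K := by
    have hcl : a ∈ closure {x : ℝ | (x, v) ∈ K} :=
      ha ▸ csSup_mem_closure ⟨r.1, by simpa [← hrv] using hr⟩ hbddv
    obtain ⟨k, hk, h₁, h₂⟩ := hge
      (map_mem_closure (f := fun x => (x, v)) (by fun_prop) hcl fun x hx => hx)
    have e₂ : k.2 = v := le_antisymm (hrmax k hk) h₂
    have hk' : (k.1, v) ∈ K := by rwa [← e₂]
    have e₁ : a = k.1 := le_antisymm h₁ (ha ▸ le_csSup hbddv hk')
    rwa [e₁]
  have hP : (u, b) ∈ K := by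
    have hcl : b ∈ closure {y : ℝ | (u, y) ∈ K} :=
      hb ▸ csSup_mem_closure ⟨p.2, by simpa [← hpu] using hp⟩ hbddu
    obtain ⟨k, hk, h₁, h₂⟩ := hge
      (map_mem_closure (f := fun y => (u, y)) (by fun_prop) hcl fun y hy => hy)
    have e₁ : k.1 = u := le_antisymm (hpmax k hk) h₁
    have hk' : (u, k.2) ∈ K := by rwa [← e₁]
    have e₂ : b = k.2 := le_antisymm h₂ (hb ▸ le_csSup hbddu hk')
    rwa [e₂]
  have hau : a < u := (hpmax _ hQ).lt_of_ne fun h => hab <| by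
    subst h
    rw [le_antisymm (hb ▸ le_csSup hbddu hQ : v ≤ b) (hrmax _ hP)]
  have hbv : b < v := (hrmax _ hP).lt_of_ne fun h => hab <| by
    subst h
    rw [le_antisymm (ha ▸ le_csSup hbddv hP : u ≤ a) (hpmax _ hQ)]
  rcases hF with ⟨-, rfl⟩ | ⟨-, rfl⟩
  · exact hconv.segment_subset hP hQ
  · rintro z ⟨hz, -⟩
    have hzR : z ∈ closure R := isClosed_closure.frontier_subset hz
    rw [hR] at hzR
    obtain ⟨k, hk, hzk⟩ := hge (closure_mono inter_subset_left hzR)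
    refine hconv.mem_of_le_of_above_line hau hbv hP hQ hk (hpmax k hk) (hrmax k hk) hzk ?_
    exact closure_minimal inter_subset_right
      (isClosed_le (by fun_prop) (by fun_prop)) hzR
end

section
/- Let K ⊆ ℝ² be a nonempty q-compact convex set with (α,v) ≠ (u,β), and suppose K has nonempty interior in the q-topology. Then S_K := K ∩ (ℝ × [β,∞)) ∩ ([α,∞) × ℝ) is compact in the Euclidean topology. -/
open Set Pointwise

/-- If `q` dominates a positive multiple of each coordinate of the positive part, then a sequence
in a compact set of `ballTop q` is dominated asymptotically by a point of the set. -/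
theorem IsCompact.exists_asymptotic_upper_bound {q : ℝ × ℝ → ℝ} {m₁ m₂ : ℝ}
    (hm₁ : 0 < m₁) (hm₂ : 0 < m₂)
    (hq₁ : ∀ x, x.1 * m₁ ≤ q x) (hq₂ : ∀ x, x.2 * m₂ ≤ q x)
    {K : Set (ℝ × ℝ)} (hK : @IsCompact _ (ballTop q) K)
    {z : ℕ → ℝ × ℝ} (hz : ∀ n, z n ∈ K) :
    ∃ k ∈ K, (∀ c, (∀ᶠ n in Filter.atTop, c ≤ (z n).1) → c ≤ k.1) ∧
      ∀ c, (∀ᶠ n in Filter.atTop, c ≤ (z n).2) → c ≤ k.2 := by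
  obtain ⟨k, hkK, hk⟩ := @hK (Filter.map z Filter.atTop) inferInstance
    (Filter.le_principal_iff.2 (Filter.mem_map.2 (Filter.Eventually.of_forall hz)))
  have key : ∀ U : Set (ℝ × ℝ), @IsOpen _ (ballTop q) U → k ∈ U →
      ∃ᶠ n in Filter.atTop, z n ∈ U := fun U hU hkU =>
    @ClusterPt.frequently _ (ballTop q) _ _ (· ∈ U) hk ((@mem_nhds_iff _ (ballTop q) _ _).2 ⟨U, subset_rfl, hU, hkU⟩)
  refine ⟨k, hkK, fun c hc => ?_, fun c hc => ?_⟩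
  · by_contra! h
    have hU : @IsOpen _ (ballTop q) {x : ℝ × ℝ | x.1 < c} := by
      intro x hx
      have hx' : x.1 < c := hx
      refine ⟨(c - x.1) * m₁, mul_pos (by linarith) hm₁, fun y hy => ?_⟩
      have := lt_of_mul_lt_mul_right ((hq₁ (y - x)).trans_lt hy) hm₁.le
      simp only [Prod.fst_sub] at this
      change y.1 < c
      linarith
    obtain ⟨n, h₁, h₂⟩ := ((key _ hU h).and_eventually hc).exists
    exact absurd h₂ (not_le.2 h₁)
  · by_contra! h
    have hU : @IsOpen _ (ballTop q) {x : ℝ × ℝ | x.2 < c} := by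
      intro x hx
      have hx' : x.2 < c := hx
      refine ⟨(c - x.2) * m₂, mul_pos (by linarith) hm₂, fun y hy => ?_⟩
      have := lt_of_mul_lt_mul_right ((hq₂ (y - x)).trans_lt hy) hm₂.le
      simp only [Prod.snd_sub] at this
      change y.2 < c
      linarith
    obtain ⟨n, h₁, h₂⟩ := ((key _ hU h).and_eventually hc).exists
    exact absurd h₂ (not_le.2 h₁)

/-- The value of a limit is at most any number that bounds all eventual lower bounds. -/
theorem Filter.Tendsto.le_of_eventual_lower_bounds {f : ℕ → ℝ} {l r : ℝ}
    (hf : Filter.Tendsto f Filter.atTop (nhds l))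
    (h : ∀ c, (∀ᶠ n in Filter.atTop, c ≤ f n) → c ≤ r) : l ≤ r :=
  le_of_forall_lt_imp_le_of_dense fun c hc =>
    h c ((hf.eventually_const_lt hc).mono fun _ => le_of_lt)

/-- A convex planar set contains every point lying vertically between two of its points. -/
theorem Convex.mem_of_vertical_between {K : Set (ℝ × ℝ)} (hK : Convex ℝ K) {x lo y hi : ℝ}
    (hlo : (x, lo) ∈ K) (hhi : (x, hi) ∈ K) (h₁ : lo ≤ y) (h₂ : y ≤ hi) : (x, y) ∈ K := by
  have hy : y ∈ segment ℝ lo hi := by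
    rw [segment_eq_Icc (h₁.trans h₂)]
    exact ⟨h₁, h₂⟩
  obtain ⟨s, t, hs, ht, hst, rfl⟩ := hy
  have := hK hlo hhi hs ht hst
  simpa [← add_mul, hst] using this

/-- A convex planar set containing a lower quadrant extends indefinitely downwards on every
vertical line to the left of one of its points. -/
theorem Convex.exists_mem_vertical_le {K : Set (ℝ × ℝ)} (hK : Convex ℝ K) {w r : ℝ × ℝ}
    (hw : Set.Iic w ⊆ K) (hr : r ∈ K) {x : ℝ} (hx : x < r.1) (y : ℝ) :
    ∃ lo ≤ y, (x, lo) ∈ K := by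
  rcases le_or_gt x w.1 with h | h
  · exact ⟨min w.2 y, min_le_right _ _, hw ⟨h, min_le_left _ _⟩⟩
  · have hx' : x ∈ openSegment ℝ w.1 r.1 := by
      rw [openSegment_eq_Ioo (h.trans hx)]
      exact ⟨h, hx⟩
    obtain ⟨s, t, hs, ht, hst, rfl⟩ := hx'
    have hmem : (w.1, min w.2 ((y - t * r.2) / s)) ∈ K := hw ⟨le_rfl, min_le_left _ _⟩
    refine ⟨_, ?_, hK hmem hr hs.le ht.le hst⟩
    have := mul_le_mul_of_nonneg_left (min_le_right w.2 ((y - t * r.2) / s)) hs.le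
    rw [mul_div_cancel₀ _ hs.ne'] at this
    simp only [smul_eq_mul, Prod.smul_snd]
    linarith

/-- For a nonempty `q`-compact convex set `K ⊆ ℝ²` with `(α,v) ≠ (u,β)` and nonempty
`q`-interior, the set `S_K = K ∩ (ℝ × [β,∞)) ∩ ([α,∞) × ℝ)` is Euclidean-compact. -/
theorem SK_compact
    (N : ℝ × ℝ → ℝ)
    (hN0 : ∀ x : ℝ × ℝ, N x = 0 ↔ x = 0)
    (hNs : ∀ (c : ℝ) (x : ℝ × ℝ), N (c • x) = |c| * N x)
    (hNt : ∀ x y : ℝ × ℝ, N (x + y) ≤ N x + N y)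
    (hNl : ∀ x y : ℝ × ℝ, |x.1| ≤ |y.1| → |x.2| ≤ |y.2| → N x ≤ N y)
    (K : Set (ℝ × ℝ)) (hne : K.Nonempty) (hconv : Convex ℝ K)
    (hcomp : @IsCompact _ (ballTop (q2 N)) K)
    (u v a b : ℝ)
    (hu : u = sSup (Prod.fst '' K)) (hv : v = sSup (Prod.snd '' K))
    (ha : a = sSup {x : ℝ | (x, v) ∈ K}) (hb : b = sSup {y : ℝ | (u, y) ∈ K})
    (hab : ((a, v) : ℝ × ℝ) ≠ (u, b))
    (hint : (@interior _ (ballTop (q2 N)) K).Nonempty) :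
    IsCompact (K ∩ ((Set.univ : Set ℝ) ×ˢ Set.Ici b) ∩ (Set.Ici a ×ˢ (Set.univ : Set ℝ))) := by
  have hpos : ∀ x : ℝ × ℝ, x ≠ 0 → 0 < N x := fun x hx => by
    have h0 : N 0 ≤ N x := hNl 0 x (by simp) (by simp)
    rw [(hN0 0).2 rfl] at h0
    exact lt_of_le_of_ne h0 fun h => hx ((hN0 x).1 h.symm)
  have hm₁ : 0 < N (1, 0) := hpos _ (by simp)
  have hm₂ : 0 < N (0, 1) := hpos _ (by simp)
  have hq₁ : ∀ x : ℝ × ℝ, x.1 * N (1, 0) ≤ q2 N x := fun x => by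
    have h : N (max x.1 0, 0) ≤ q2 N x := hNl _ _ le_rfl (by simp)
    have e := hNs (max x.1 0) (1, 0)
    rw [abs_of_nonneg (le_max_right _ _)] at e
    simp only [Prod.smul_mk, smul_eq_mul, mul_one, mul_zero] at e
    rw [e] at h
    exact (mul_le_mul_of_nonneg_right (le_max_left _ _) hm₁.le).trans h
  have hq₂ : ∀ x : ℝ × ℝ, x.2 * N (0, 1) ≤ q2 N x := fun x => by
    have h : N (0, max x.2 0) ≤ q2 N x := hNl _ _ (by simp) le_rfl
    have e := hNs (max x.2 0) (0, 1)
    rw [abs_of_nonneg (le_max_right _ _)] at e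
    simp only [Prod.smul_mk, smul_eq_mul, mul_one, mul_zero] at e
    rw [e] at h
    exact (mul_le_mul_of_nonneg_right (le_max_left _ _) hm₂.le).trans h
  have seq : ∀ z : ℕ → ℝ × ℝ, (∀ n, z n ∈ K) →
      ∃ k ∈ K, (∀ c, (∀ᶠ n in Filter.atTop, c ≤ (z n).1) → c ≤ k.1) ∧
        ∀ c, (∀ᶠ n in Filter.atTop, c ≤ (z n).2) → c ≤ k.2 :=
    fun z hz => IsCompact.exists_asymptotic_upper_bound hm₁ hm₂ hq₁ hq₂ hcomp hz
  have large : ∀ c : ℝ, ∀ᶠ n : ℕ in Filter.atTop, c ≤ n :=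
    fun c => tendsto_natCast_atTop_atTop.eventually_ge_atTop c
  have bdd₁ : BddAbove (Prod.fst '' K) := by
    by_contra h
    rw [not_bddAbove_iff] at h
    have h' : ∀ n : ℕ, ∃ x ∈ K, (n : ℝ) < x.1 := fun n => by simpa using h n
    choose z hzK hz using h'
    obtain ⟨k, -, hk, -⟩ := seq z hzK
    linarith [hk (k.1 + 1) ((large _).mono fun n hn => hn.trans (hz n).le)]
  have bdd₂ : BddAbove (Prod.snd '' K) := by
    by_contra h
    rw [not_bddAbove_iff] at h
    have h' : ∀ n : ℕ, ∃ x ∈ K, (n : ℝ) < x.2 := fun n => by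
      obtain ⟨_, ⟨x, hx, rfl⟩, hn⟩ := h n
      exact ⟨x, hx, hn⟩
    choose z hzK hz using h'
    obtain ⟨k, -, -, hk⟩ := seq z hzK
    linarith [hk (k.2 + 1) ((large _).mono fun n hn => hn.trans (hz n).le)]
  have le_u : ∀ x ∈ K, x.1 ≤ u := fun x hx => hu ▸ le_csSup bdd₁ ⟨x, hx, rfl⟩
  have le_v : ∀ x ∈ K, x.2 ≤ v := fun x hx => hv ▸ le_csSup bdd₂ ⟨x, hx, rfl⟩
  have v_attained : ∃ x, (x, v) ∈ K := by
    obtain ⟨f, -, hf, hfK⟩ := exists_seq_tendsto_sSup (hne.image Prod.snd) bdd₂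
    choose z hzK hz using hfK
    obtain ⟨k, hkK, -, hk⟩ := seq z hzK
    have hvk : v ≤ k.2 := by
      rw [hv]
      refine hf.le_of_eventual_lower_bounds fun c hc => hk c (hc.mono fun n hn => ?_)
      rwa [hz n]
    exact ⟨k.1, by rwa [le_antisymm hvk (le_v k hkK)]⟩
  have hav : (a, v) ∈ K := by
    have bdd : BddAbove {x : ℝ | (x, v) ∈ K} := ⟨u, fun x hx => le_u _ hx⟩
    obtain ⟨f, -, hf, hfK⟩ := exists_seq_tendsto_sSup v_attained bdd
    obtain ⟨k, hkK, hk₁, hk₂⟩ := seq (fun n => (f n, v)) hfK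
    have h₂ : k.2 = v := le_antisymm (le_v k hkK) (hk₂ v (by simp))
    have h₁ : a ≤ k.1 := by
      rw [ha]
      exact hf.le_of_eventual_lower_bounds hk₁
    have h₁' : k.1 ≤ a := by
      rw [ha]
      exact le_csSup bdd (by change (k.1, v) ∈ K; rwa [← h₂])
    rwa [le_antisymm h₁ h₁', ← h₂]
  obtain ⟨w, hw⟩ : ∃ w, Set.Iic w ⊆ K := by
    obtain ⟨w, U, ⟨hU, hUK⟩, hwU⟩ := hint
    obtain ⟨ε, hε, h⟩ := hU w hwU
    refine ⟨w, fun y hy => hUK (h y ?_)⟩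
    have hy₁ : y.1 - w.1 ≤ 0 := sub_nonpos.2 hy.1
    have hy₂ : y.2 - w.2 ≤ 0 := sub_nonpos.2 hy.2
    have h0 : q2 N (y - w) = 0 := by
      simp only [q2, Prod.fst_sub, Prod.snd_sub, max_eq_right hy₁, max_eq_right hy₂]
      exact (hN0 _).2 rfl
    rwa [h0]
  refine Metric.isCompact_of_isClosed_isBounded (IsSeqClosed.isClosed ?_) ?_
  · intro z p hz hp
    obtain ⟨k, hkK, hk₁, hk₂⟩ := seq z fun n => (hz n).1.1
    have hp₁ := (continuous_fst.tendsto p).comp hp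
    have hp₂ := (continuous_snd.tendsto p).comp hp
    have hpk₁ : p.1 ≤ k.1 := hp₁.le_of_eventual_lower_bounds hk₁
    have hpk₂ : p.2 ≤ k.2 := hp₂.le_of_eventual_lower_bounds hk₂
    have hap : a ≤ p.1 := ge_of_tendsto' hp₁ fun n => (hz n).2.1
    have hbp : b ≤ p.2 := ge_of_tendsto' hp₂ fun n => (hz n).1.2.2
    suffices hpK : p ∈ K from ⟨⟨hpK, trivial, hbp⟩, hap, trivial⟩
    by_cases hr : ∃ r ∈ K, p.1 < r.1
    · obtain ⟨r, hrK, hr⟩ := hr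
      obtain ⟨lo, hlo, hloK⟩ := hconv.exists_mem_vertical_le hw hrK hr p.2
      have hseg : p.1 ∈ segment ℝ a k.1 := by
        rw [segment_eq_Icc (hap.trans hpk₁)]
        exact ⟨hap, hpk₁⟩
      obtain ⟨s, t, hs, ht, hst, hp⟩ := hseg
      have hhi := hconv hav hkK hs ht hst
      have hpv : p.2 ≤ v := hpk₂.trans (le_v k hkK)
      refine hconv.mem_of_vertical_between hloK (hi := s * v + t * k.2) ?_ hlo ?_
      · rw [← hp]
        exact hhi
      · calc p.2 = s * p.2 + t * p.2 := by rw [← add_mul, hst, one_mul]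
          _ ≤ s * v + t * k.2 := by gcongr
    · push Not at hr
      have hpu : p.1 = u := by
        refine le_antisymm (hpk₁.trans (le_u k hkK)) ?_
        rw [hu]
        exact csSup_le (hne.image _) (by rintro _ ⟨x, hx, rfl⟩; exact hr x hx)
      have hk : k.1 = p.1 := le_antisymm (hr k hkK) hpk₁
      have hkb : k.2 ≤ b := by
        rw [hb]
        refine le_csSup ⟨v, fun y hy => le_v _ hy⟩ ?_
        change (u, k.2) ∈ K
        rwa [← hpu, ← hk]
      rwa [show p = k from Prod.ext hk.symm (le_antisymm hpk₂ (hkb.trans hbp))]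
  · refine (Metric.isBounded_Icc (a, b) (u, v)).subset fun x hx => ?_
    exact ⟨⟨hx.2.1, hx.1.2.2⟩, le_u x hx.1.1, le_v x hx.1.1⟩
end

section
/- Every q-compact convex set K ⊆ ℝ² is strongly q-compact: there exists a Euclidean-compact set K₀ with K₀ ⊆ K ⊆ K₀ + θ₀. -/
open Set Pointwise

/-- A Euclidean-open lower set is open in the `q`-topology. -/
lemma isOpen_ballTop_of_isLowerSet {N : ℝ × ℝ → ℝ}
    (hN0 : ∀ x : ℝ × ℝ, N x = 0 ↔ x = 0)
    (hNs : ∀ (c : ℝ) (x : ℝ × ℝ), N (c • x) = |c| * N x)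
    (hNl : ∀ x y : ℝ × ℝ, |x.1| ≤ |y.1| → |x.2| ≤ |y.2| → N x ≤ N y)
    {U : Set (ℝ × ℝ)} (hU : IsOpen U) (hlow : IsLowerSet U) :
    @IsOpen _ (ballTop (q2 N)) U := by
  have hpos : ∀ x : ℝ × ℝ, x ≠ 0 → 0 < N x := fun x hx => by
    have h := hNl 0 x (by simp) (by simp)
    rw [(hN0 0).2 rfl] at h
    exact lt_of_le_of_ne h fun h' => hx ((hN0 x).1 h'.symm)
  have h₁ : 0 < N (1, 0) := hpos _ (by simp)
  have h₂ : 0 < N (0, 1) := hpos _ (by simp)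
  intro x hx
  obtain ⟨δ, hδ, hball⟩ := Metric.isOpen_iff.1 hU x hx
  refine ⟨δ * min (N (1, 0)) (N (0, 1)), mul_pos hδ (lt_min h₁ h₂), fun y hy => ?_⟩
  have hfst : max (y.1 - x.1) 0 < δ := by
    have h := hNl (max (y.1 - x.1) 0 • ((1 : ℝ), (0 : ℝ)))
      (max (y.1 - x.1) 0, max (y.2 - x.2) 0) (by simp) (by simp)
    rw [hNs, abs_of_nonneg (le_max_right _ _)] at h
    refine lt_of_mul_lt_mul_right (h.trans_lt (lt_of_lt_of_le hy ?_)) h₁.le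
    exact mul_le_mul_of_nonneg_left (min_le_left _ _) hδ.le
  have hsnd : max (y.2 - x.2) 0 < δ := by
    have h := hNl (max (y.2 - x.2) 0 • ((0 : ℝ), (1 : ℝ)))
      (max (y.1 - x.1) 0, max (y.2 - x.2) 0) (by simp) (by simp)
    rw [hNs, abs_of_nonneg (le_max_right _ _)] at h
    refine lt_of_mul_lt_mul_right (h.trans_lt (lt_of_lt_of_le hy ?_)) h₂.le
    exact mul_le_mul_of_nonneg_left (min_le_right _ _) hδ.le
  have hmem : (x.1 + max (y.1 - x.1) 0, x.2 + max (y.2 - x.2) 0) ∈ U := by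
    apply hball
    rw [Metric.mem_ball, Prod.dist_eq, Real.dist_eq, Real.dist_eq]
    simp only [add_sub_cancel_left]
    rw [abs_of_nonneg (le_max_right _ _), abs_of_nonneg (le_max_right _ _)]
    exact max_lt hfst hsnd
  refine hlow ⟨?_, ?_⟩ hmem
  · linarith [le_max_left (y.1 - x.1) 0]
  · linarith [le_max_left (y.2 - x.2) 0]

/-- A continuous monotone function attains its maximum on a nonempty set that is compact for a
ball topology in which Euclidean-open lower sets are open. -/
lemma exists_forall_le_of_monotone {q : ℝ × ℝ → ℝ}
    (ht : ∀ U : Set (ℝ × ℝ), IsOpen U → IsLowerSet U → @IsOpen _ (ballTop q) U)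
    {K : Set (ℝ × ℝ)} (hK : @IsCompact _ (ballTop q) K) (hne : K.Nonempty)
    {f : ℝ × ℝ → ℝ} (hf : Continuous f) (hmono : Monotone f) :
    ∃ a ∈ K, ∀ y ∈ K, f y ≤ f a := by
  have husc : @UpperSemicontinuous _ _ (ballTop q) _ f :=
    (@upperSemicontinuous_iff_isOpen_preimage _ _ (ballTop q) f).2 fun c =>
      ht _ (isOpen_Iio.preimage hf) fun _ _ hyx hx => (hmono hyx).trans_lt hx
  obtain ⟨a, ha, hmax⟩ :=
    @UpperSemicontinuousOn.exists_isMaxOn _ (ballTop q) _ _ f K hne hK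
      (@UpperSemicontinuous.upperSemicontinuousOn _ _ (ballTop q) _ f husc K)
  exact ⟨a, ha, fun y hy => hmax hy⟩

/-- A set that is compact for a topology in which Euclidean-open lower sets are open has a
Euclidean-closed lower closure. -/
lemma isClosed_lowerClosure_of_isCompact {q : ℝ × ℝ → ℝ}
    (ht : ∀ U : Set (ℝ × ℝ), IsOpen U → IsLowerSet U → @IsOpen _ (ballTop q) U)
    {K : Set (ℝ × ℝ)} (hK : @IsCompact _ (ballTop q) K) (hne : K.Nonempty) :
    IsClosed {z : ℝ × ℝ | ∃ k ∈ K, z ≤ k} := by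
  refine isClosed_of_closure_subset fun z hz => ?_
  obtain ⟨k, hk, hmax⟩ := exists_forall_le_of_monotone ht hK hne
    (f := fun y => min (y.1 - z.1) (y.2 - z.2)) (by fun_prop)
    (fun x y h => min_le_min (sub_le_sub_right h.1 _) (sub_le_sub_right h.2 _))
  have hnonneg : 0 ≤ min (k.1 - z.1) (k.2 - z.2) := by
    refine le_of_forall_pos_le_add fun ε hε => ?_
    obtain ⟨w, ⟨y, hy, hwy⟩, hw⟩ := Metric.mem_closure_iff.1 hz ε hε
    rw [Prod.dist_eq, max_lt_iff, Real.dist_eq, Real.dist_eq, abs_lt, abs_lt] at hw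
    have h₁ := hwy.1
    have h₂ := hwy.2
    have h : -ε ≤ min (y.1 - z.1) (y.2 - z.2) := le_min (by linarith) (by linarith)
    have := hmax y hy
    linarith
  rw [le_min_iff] at hnonneg
  exact ⟨k, hk, by linarith, by linarith⟩

/-- A point of a segment of negative slope with prescribed first coordinate. -/
lemma Convex.mk_chord_mem {K : Set (ℝ × ℝ)} (hconv : Convex ℝ K) {a b : ℝ × ℝ} (ha : a ∈ K)
    (hb : b ∈ K) (h : b.1 < a.1) {u : ℝ} (hbu : b.1 ≤ u) (hua : u ≤ a.1) :
    (u, a.2 + (b.2 - a.2) * ((a.1 - u) / (a.1 - b.1))) ∈ K := by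
  have hD : 0 < a.1 - b.1 := sub_pos.2 h
  convert hconv.add_smul_sub_mem ha hb (t := (a.1 - u) / (a.1 - b.1))
    ⟨div_nonneg (by linarith) hD.le, (div_le_one hD).2 (by linarith)⟩ using 1
  ext
  · simp
    field_simp
    ring
  · simp
    ring

/-- The vertical sections of a convex set are order connected. -/
lemma Convex.vertical_mem {K : Set (ℝ × ℝ)} (hconv : Convex ℝ K) {u r s v : ℝ}
    (hr : (u, r) ∈ K) (hs : (u, s) ∈ K) (hrv : r ≤ v) (hvs : v ≤ s) : (u, v) ∈ K := by
  have hpre : Convex ℝ ((fun v : ℝ => (u, v)) ⁻¹' K) := by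
    intro x hx y hy α β hα hβ hαβ
    have := hconv hx hy hα hβ hαβ
    rw [mem_preimage]
    convert this using 1
    ext <;> simp [← add_mul, hαβ]
  exact hpre.ordConnected.out hr hs ⟨hrv, hvs⟩

/-- A point of the region above the chord `[a, b]` lies in the convex set `K` as soon as some
point of `K` vertically above it does. -/
lemma Convex.mem_of_above_chord {K : Set (ℝ × ℝ)} (hconv : Convex ℝ K) {a b : ℝ × ℝ}
    (ha : a ∈ K) (hb : b ∈ K) (h : b.1 < a.1) {u v s : ℝ} (hs : (u, s) ∈ K) (hvs : v ≤ s)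
    (hbu : b.1 ≤ u) (hua : u ≤ a.1)
    (hchord : 0 ≤ (b.2 - a.2) * (u - a.1) + (a.1 - b.1) * (v - a.2)) : (u, v) ∈ K := by
  refine hconv.vertical_mem (hconv.mk_chord_mem ha hb h hbu hua) hs ?_ hvs
  have hD : 0 < a.1 - b.1 := sub_pos.2 h
  rw [← mul_div_assoc, ← le_sub_iff_add_le', div_le_iff₀ hD]
  linarith

/-- The part of the lower closure of a convex set `K` above a chord `[a, b]` joining a rightmost
point `a` to a topmost point `b` is contained in `K`. -/
lemma Convex.mem_of_le_of_above_chord {K : Set (ℝ × ℝ)} (hconv : Convex ℝ K) {a b : ℝ × ℝ}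
    (ha : a ∈ K) (hb : b ∈ K) (h₁ : b.1 < a.1) (h₂ : a.2 < b.2)
    (hamax : ∀ y ∈ K, y.1 ≤ a.1) (hbmax : ∀ y ∈ K, y.2 ≤ b.2) {z k : ℝ × ℝ} (hk : k ∈ K)
    (hzk : z ≤ k) (hchord : 0 ≤ (b.2 - a.2) * (z.1 - a.1) + (a.1 - b.1) * (z.2 - a.2)) :
    z ∈ K := by
  have hz₁ := hzk.1
  have hz₂ := hzk.2
  have hk₁ := hamax k hk
  have hk₂ := hbmax k hk
  have hbz : b.1 ≤ z.1 := by nlinarith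
  have haz : a.2 ≤ z.2 := by nlinarith
  have hstep : (k.1, z.2) ∈ K :=
    hconv.mem_of_above_chord ha hb h₁ (s := k.2) hk hz₂ (hbz.trans hz₁) hk₁ (by nlinarith)
  have hswap : Convex ℝ (Prod.swap ⁻¹' K) :=
    hconv.linear_preimage (LinearEquiv.prodComm ℝ ℝ ℝ).toLinearMap
  have hmem : (z.2, z.1) ∈ Prod.swap ⁻¹' K :=
    hswap.mem_of_above_chord (a := b.swap) (b := a.swap) (by simpa using hb) (by simpa using ha)
      h₂ (s := k.1) hstep hz₁ haz (hz₂.trans hk₂)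
      (by simp only [Prod.fst_swap, Prod.snd_swap]; linarith)
  exact hmem

/-- Every `q`-compact convex set `K ⊆ ℝ²` is strongly `q`-compact: there is a
Euclidean-compact set `K₀` with `K₀ ⊆ K ⊆ K₀ + θ₀`. -/
theorem strongly_qCompact_of_qCompact_convex
    (N : ℝ × ℝ → ℝ)
    (hN0 : ∀ x : ℝ × ℝ, N x = 0 ↔ x = 0)
    (hNs : ∀ (c : ℝ) (x : ℝ × ℝ), N (c • x) = |c| * N x)
    (hNt : ∀ x y : ℝ × ℝ, N (x + y) ≤ N x + N y)
    (hNl : ∀ x y : ℝ × ℝ, |x.1| ≤ |y.1| → |x.2| ≤ |y.2| → N x ≤ N y)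
    (K : Set (ℝ × ℝ)) (hconv : Convex ℝ K)
    (hcomp : @IsCompact _ (ballTop (q2 N)) K) :
    ∃ K₀ : Set (ℝ × ℝ), IsCompact K₀ ∧ K₀ ⊆ K ∧ K ⊆ K₀ + theta0 N := by
  rcases K.eq_empty_or_nonempty with rfl | hne
  · exact ⟨∅, isCompact_empty, Subset.rfl, empty_subset _⟩
  have ht : ∀ U : Set (ℝ × ℝ), IsOpen U → IsLowerSet U → @IsOpen _ (ballTop (q2 N)) U :=
    fun U => isOpen_ballTop_of_isLowerSet hN0 hNs hNl
  have hsum : ∀ {S : Set (ℝ × ℝ)} {k m : ℝ × ℝ}, m ∈ S → k ≤ m → k ∈ S + theta0 N := by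
    intro S k m hm hkm
    refine ⟨m, hm, k - m, ?_, add_sub_cancel _ _⟩
    have h₁ : (k - m).1 ≤ 0 := sub_nonpos.2 hkm.1
    have h₂ : (k - m).2 ≤ 0 := sub_nonpos.2 hkm.2
    rw [theta0, mem_ofPred_eq, q2, max_eq_right h₁, max_eq_right h₂]
    exact (hN0 _).2 rfl
  have hinter : ∀ f : ℝ × ℝ → ℝ, Continuous f → Monotone f → ∀ c,
      @IsCompact _ (ballTop (q2 N)) (K ∩ {y | c ≤ f y}) := by
    intro f hf hmono c
    refine @IsCompact.inter_right _ (ballTop (q2 N)) _ _ hcomp ?_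
    refine (@isOpen_compl_iff _ _ (ballTop (q2 N))).1 (ht _ ?_ ?_)
    · exact (isClosed_le continuous_const hf).isOpen_compl
    · exact fun x y hyx hx hy => hx (le_trans hy (hmono hyx))
  obtain ⟨a', ha', hamax'⟩ :=
    exists_forall_le_of_monotone ht hcomp hne continuous_fst monotone_fst
  obtain ⟨b', hb', hbmax'⟩ :=
    exists_forall_le_of_monotone ht hcomp hne continuous_snd monotone_snd
  obtain ⟨a, ⟨ha, haa'⟩, hamax⟩ := exists_forall_le_of_monotone ht
    (hinter _ continuous_fst monotone_fst a'.1) ⟨a', ha', le_refl a'.1⟩ continuous_snd monotone_snd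
  obtain ⟨b, ⟨hb, hbb'⟩, hbmax⟩ := exists_forall_le_of_monotone ht
    (hinter _ continuous_snd monotone_snd b'.2) ⟨b', hb', le_refl b'.2⟩ continuous_fst monotone_fst
  have haK : ∀ y ∈ K, y.1 ≤ a.1 := fun y hy => (hamax' y hy).trans haa'
  have hbK : ∀ y ∈ K, y.2 ≤ b.2 := fun y hy => (hbmax' y hy).trans hbb'
  rcases le_or_gt a.1 b.1 with hab | h₁
  · have hba : b.2 ≤ a.2 := hamax b ⟨hb, le_trans haa' hab⟩
    exact ⟨{a}, isCompact_singleton, singleton_subset_iff.2 ha, fun k hk =>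
      hsum (mem_singleton a) ⟨haK k hk, (hbK k hk).trans hba⟩⟩
  have h₂ : a.2 < b.2 := by
    by_contra! hba
    exact h₁.not_ge (hbmax a ⟨ha, le_trans hbb' hba⟩)
  set K₀ : Set (ℝ × ℝ) := {z | ∃ k ∈ K, z ≤ k} ∩
    {z | 0 ≤ (b.2 - a.2) * (z.1 - a.1) + (a.1 - b.1) * (z.2 - a.2)}
  have hsub : K₀ ⊆ K := fun z ⟨⟨k, hk, hzk⟩, hz⟩ =>
    hconv.mem_of_le_of_above_chord ha hb h₁ h₂ haK hbK hk hzk hz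
  have hclosed : IsClosed K₀ := (isClosed_lowerClosure_of_isCompact ht hcomp hne).inter
    (isClosed_le continuous_const (by fun_prop))
  have hbox : K₀ ⊆ Icc (b.1, a.2) (a.1, b.2) := by
    intro z hz
    have hz₁ := haK z (hsub hz)
    have hz₂ := hbK z (hsub hz)
    have hz₀ : 0 ≤ (b.2 - a.2) * (z.1 - a.1) + (a.1 - b.1) * (z.2 - a.2) := hz.2
    exact ⟨⟨by simp only; nlinarith, by simp only; nlinarith⟩, hz₁, hz₂⟩
  have haK₀ : a ∈ K₀ := ⟨⟨a, ha, le_rfl⟩, by simp⟩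
  have hbK₀ : b ∈ K₀ := ⟨⟨b, hb, le_rfl⟩, by
    rw [mem_ofPred_eq]
    linarith⟩
  refine ⟨K₀, isCompact_Icc.of_isClosed_subset hclosed hbox, hsub, fun k hk => ?_⟩
  rcases le_or_gt 0 ((b.2 - a.2) * (k.1 - a.1) + (a.1 - b.1) * (k.2 - a.2)) with hk₀ | hk₀
  · exact hsum (S := K₀) ⟨⟨k, hk, le_rfl⟩, hk₀⟩ le_rfl
  rcases le_or_gt k.1 b.1 with hkb | hkb
  · exact hsum hbK₀ ⟨hkb, hbK k hk⟩
  have hD : 0 < a.1 - b.1 := sub_pos.2 h₁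
  refine hsum (S := K₀)
    ⟨⟨_, hconv.mk_chord_mem ha hb h₁ hkb.le (haK k hk), le_rfl⟩, ?_⟩ ⟨le_rfl, ?_⟩
  · rw [mem_ofPred_eq]
    refine le_of_eq ?_
    field_simp
    ring
  · simp only
    rw [← mul_div_assoc, ← sub_le_iff_le_add', le_div_iff₀ hD]
    linarith
end

section
/- Let α < u and β < v be real numbers, s₀ ∈ [−∞, α], t₀ ∈ [−∞, β], and let K₀ be a convex set compact in the Euclidean topology with co{(α,v),(α,β),(u,β)} ⊆ K₀ ⊆ co{(α,v),(α,β),(u,β),(u,v)}. Let V be either {u} × (t₀, β] or {u} × [t₀, β], let W be either {(s, v) : s₀ < s ≤ α} or {(s, v) : s₀ ≤ s ≤ α}, and set K := K₀ ∪ ((α,v) + int_q(θ₀)) ∪ ((u,β) + int_q(θ₀)) ∪ V ∪ W. If K is convex and K₀ ⊆ K ⊆ K₀ + θ₀, then K is a q-compact convex body. -/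
open Set Pointwise

/-- The possible forms of the vertical piece `V`: either `{u} × (t₀, c]` for a real `t₀ ≤ c`,
or `{u} × [t₀, c]` for a real `t₀ ≤ c`, or (the case `t₀ = -∞`) `{u} × (-∞, c]`. -/
def Vform (u c : ℝ) (V : Set (ℝ × ℝ)) : Prop :=
  (∃ t₀ : ℝ, t₀ ≤ c ∧ V = ({u} : Set ℝ) ×ˢ Set.Ioc t₀ c) ∨
  (∃ t₀ : ℝ, t₀ ≤ c ∧ V = ({u} : Set ℝ) ×ˢ Set.Icc t₀ c) ∨
  V = ({u} : Set ℝ) ×ˢ Set.Iic c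

/-- The possible forms of the horizontal piece `W`: either `(s₀, e] × {v}` for a real `s₀ ≤ e`,
or `[s₀, e] × {v}` for a real `s₀ ≤ e`, or (the case `s₀ = -∞`) `(-∞, e] × {v}`. -/
def Wform (v e : ℝ) (W : Set (ℝ × ℝ)) : Prop :=
  (∃ s₀ : ℝ, s₀ ≤ e ∧ W = Set.Ioc s₀ e ×ˢ ({v} : Set ℝ)) ∨
  (∃ s₀ : ℝ, s₀ ≤ e ∧ W = Set.Icc s₀ e ×ˢ ({v} : Set ℝ)) ∨
  W = Set.Iic e ×ˢ ({v} : Set ℝ)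

/-- A superset of a compact set all of whose points specialize to points of that set is compact. -/
theorem IsCompact.of_superset_of_specializes {X : Type*} [TopologicalSpace X] {S T : Set X}
    (hS : IsCompact S) (hST : S ⊆ T) (hT : ∀ t ∈ T, ∃ s ∈ S, t ⤳ s) : IsCompact T := by
  refine isCompact_of_finite_subcover fun U hUo hU => ?_
  obtain ⟨F, hF⟩ := hS.elim_finite_subcover U hUo (hST.trans hU)
  refine ⟨F, fun t ht => ?_⟩
  obtain ⟨s, hs, hts⟩ := hT t ht
  obtain ⟨i, hi, hsi⟩ := mem_iUnion₂.1 (hF hs)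
  exact mem_iUnion₂.2 ⟨i, hi, hts.mem_open (hUo i) hsi⟩

theorem isOpen_ballTop_iff {X : Type*} [Sub X] {q : X → ℝ} {U : Set X} :
    @IsOpen X (ballTop q) U ↔ ∀ x ∈ U, ∃ ε > 0, ∀ y, q (y - x) < ε → y ∈ U :=
  Iff.rfl

theorem specializes_ballTop {X : Type*} [Sub X] {q : X → ℝ} {x y : X} (h : q (y - x) ≤ 0) :
    @Specializes X (ballTop q) y x := by
  refine (@specializes_iff_forall_open X (ballTop q) y x).2 fun U hU hx => ?_
  obtain ⟨ε, hε, hball⟩ := isOpen_ballTop_iff.1 hU x hx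
  exact hball y (h.trans_lt hε)

theorem ballTop_le_of_continuous {X : Type*} [AddGroup X] [t : TopologicalSpace X]
    [ContinuousSub X] {q : X → ℝ} (hq : Continuous q) (hq0 : q 0 = 0) : t ≤ ballTop q := by
  intro U hU
  refine isOpen_iff_mem_nhds.2 fun x hx => ?_
  obtain ⟨ε, hε, hball⟩ := isOpen_ballTop_iff.1 hU x hx
  have hc : Continuous fun y => q (y - x) := hq.comp (continuous_id.sub continuous_const)
  have hlt : ∀ᶠ y in nhds x, q (y - x) < ε :=
    hc.continuousAt.eventually_lt continuousAt_const (by simpa [hq0] using hε)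
  exact hlt.mono hball

theorem IsOpen.transl_q2 {N : ℝ × ℝ → ℝ} {S : Set (ℝ × ℝ)} (hS : @IsOpen _ (ballTop (q2 N)) S)
    (a : ℝ × ℝ) : @IsOpen _ (ballTop (q2 N)) (transl a S) := by
  refine isOpen_ballTop_iff.2 ?_
  rintro _ ⟨x, hx, rfl⟩
  obtain ⟨ε, hε, hball⟩ := isOpen_ballTop_iff.1 hS x hx
  refine ⟨ε, hε, fun y hy => ⟨y - a, hball _ ?_, add_sub_cancel a y⟩⟩
  rwa [sub_sub]

section LatticeNorm

variable {N : ℝ × ℝ → ℝ}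

theorem continuous_of_lattice_norm (hNs : ∀ (c : ℝ) (x : ℝ × ℝ), N (c • x) = |c| * N x)
    (hNt : ∀ x y : ℝ × ℝ, N (x + y) ≤ N x + N y)
    (hNl : ∀ x y : ℝ × ℝ, |x.1| ≤ |y.1| → |x.2| ≤ |y.2| → N x ≤ N y) : Continuous N := by
  have hN0 : N 0 = 0 := by simpa using hNs 0 0
  have hpos : 0 ≤ N (1, 1) := hN0 ▸ hNl 0 (1, 1) (by simp) (by simp)
  have hbound : ∀ x, N x ≤ N (1, 1) * ‖x‖ := fun x => by
    have h := hNl x (‖x‖ • (1, 1)) (by simpa using norm_fst_le x) (by simpa using norm_snd_le x)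
    rwa [hNs, abs_norm, mul_comm] at h
  refine (LipschitzWith.of_le_add_mul ⟨N (1, 1), hpos⟩ fun x y => ?_).continuous
  calc N x = N (y + (x - y)) := by rw [add_sub_cancel]
    _ ≤ N y + N (x - y) := hNt _ _
    _ ≤ N y + N (1, 1) * dist x y := by rw [dist_eq_norm]; gcongr; exact hbound _

theorem exists_forall_q2_lt_imp (hN0 : ∀ x : ℝ × ℝ, N x = 0 ↔ x = 0)
    (hNl : ∀ x y : ℝ × ℝ, |x.1| ≤ |y.1| → |x.2| ≤ |y.2| → N x ≤ N y) {r : ℝ} (hr : 0 < r) :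
    ∃ ε > 0, ∀ x, q2 N x < ε → x.1 < r ∧ x.2 < r := by
  have hpos : ∀ x, x ≠ 0 → 0 < N x := fun x hx =>
    lt_of_le_of_ne ((hN0 0).2 rfl ▸ hNl 0 x (by simp) (by simp)) (Ne.symm (mt (hN0 x).1 hx))
  refine ⟨min (N (r, 0)) (N (0, r)),
    lt_min (hpos _ (by simp [hr.ne'])) (hpos _ (by simp [hr.ne'])), fun x hx => ⟨?_, ?_⟩⟩
  · by_contra! h
    refine (hx.trans_le (min_le_left _ _)).not_ge (hNl _ _ ?_ (by simp))
    exact abs_le_abs_of_nonneg hr.le (h.trans (le_max_left _ _))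
  · by_contra! h
    refine (hx.trans_le (min_le_right _ _)).not_ge (hNl _ _ (by simp) ?_)
    exact abs_le_abs_of_nonneg hr.le (h.trans (le_max_left _ _))

theorem thetaIntQ_nonempty (hN0 : ∀ x : ℝ × ℝ, N x = 0 ↔ x = 0)
    (hNl : ∀ x y : ℝ × ℝ, |x.1| ≤ |y.1| → |x.2| ≤ |y.2| → N x ≤ N y) :
    (thetaIntQ N).Nonempty := by
  refine ⟨(-1, -1), (@mem_interior _ (ballTop (q2 N)) _ _).2
    ⟨Iio 0 ×ˢ Iio 0, fun x hx => ?_, isOpen_ballTop_iff.2 fun x hx => ?_, by simp⟩⟩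
  · exact (hN0 _).2 (Prod.ext (max_eq_right (le_of_lt hx.1)) (max_eq_right (le_of_lt hx.2)))
  · have hx1 : x.1 < 0 := hx.1
    have hx2 : x.2 < 0 := hx.2
    obtain ⟨ε, hε, h⟩ := exists_forall_q2_lt_imp hN0 hNl
      (lt_min (neg_pos.2 hx1) (neg_pos.2 hx2))
    refine ⟨ε, hε, fun y hy => ?_⟩
    obtain ⟨h1, h2⟩ := h _ hy
    have h1' := h1.trans_le (min_le_left _ _)
    have h2' := h2.trans_le (min_le_right _ _)
    simp only [Prod.fst_sub, Prod.snd_sub] at h1' h2'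
    exact ⟨show y.1 < 0 by linarith, show y.2 < 0 by linarith⟩

end LatticeNorm

/-- Structure theorem, sufficiency, case (2): such a set is a `q`-compact convex body. -/
theorem qCompact_convex_body_of_generic_form
    (N : ℝ × ℝ → ℝ)
    (hN0 : ∀ x : ℝ × ℝ, N x = 0 ↔ x = 0)
    (hNs : ∀ (c : ℝ) (x : ℝ × ℝ), N (c • x) = |c| * N x)
    (hNt : ∀ x y : ℝ × ℝ, N (x + y) ≤ N x + N y)
    (hNl : ∀ x y : ℝ × ℝ, |x.1| ≤ |y.1| → |x.2| ≤ |y.2| → N x ≤ N y)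
    (a u b v : ℝ) (hau : a < u) (hbv : b < v)
    (K₀ : Set (ℝ × ℝ)) (hK₀conv : Convex ℝ K₀) (hK₀comp : IsCompact K₀)
    (hK₀lo : convexHull ℝ ({(a, v), (a, b), (u, b)} : Set (ℝ × ℝ)) ⊆ K₀)
    (hK₀hi : K₀ ⊆ convexHull ℝ ({(a, v), (a, b), (u, b), (u, v)} : Set (ℝ × ℝ)))
    (V W K : Set (ℝ × ℝ))
    (hV : Vform u b V) (hW : Wform v a W)
    (hK : K = K₀ ∪ transl (a, v) (thetaIntQ N) ∪ transl (u, b) (thetaIntQ N) ∪ V ∪ W)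
    (hKconv : Convex ℝ K)
    (hlo : K₀ ⊆ K) (hhi : K ⊆ K₀ + theta0 N) :
    @IsCompact _ (ballTop (q2 N)) K ∧ Convex ℝ K ∧
      (@interior _ (ballTop (q2 N)) K).Nonempty := by
  have hcont : Continuous (q2 N) := by
    have := continuous_of_lattice_norm hNs hNt hNl
    unfold q2
    fun_prop
  have hq0 : q2 N 0 = 0 := (hN0 _).2 (by simp)
  refine ⟨?_, hKconv, ?_⟩
  · have hK₀q : @IsCompact _ (ballTop (q2 N)) K₀ := by
      simpa using @IsCompact.image _ _ _ (ballTop (q2 N)) _ id hK₀comp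
        (continuous_id_iff_le.2 (ballTop_le_of_continuous hcont hq0))
    refine @IsCompact.of_superset_of_specializes _ (ballTop (q2 N)) _ _ hK₀q hlo fun y hy => ?_
    obtain ⟨x, hx, z, hz, rfl⟩ := hhi hy
    refine ⟨x, hx, specializes_ballTop (le_of_eq ?_)⟩
    simpa using (show q2 N z = 0 from hz)
  · obtain ⟨z, hz⟩ := thetaIntQ_nonempty hN0 hNl
    refine ⟨(a, v) + z, (@mem_interior _ (ballTop (q2 N)) _ _).2
      ⟨transl (a, v) (thetaIntQ N), ?_, ?_, mem_image_of_mem _ hz⟩⟩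
    · rw [hK]
      exact fun x hx => .inl (.inl (.inl (.inr hx)))
    · exact IsOpen.transl_q2 (@isOpen_interior _ (ballTop (q2 N)) _) _
end

section
/- Let K ⊆ ℝ² be a q-compact convex body. Then there exist a convex set K' contained in the Euclidean closure of B₁^q(0), of the form K' = B₁^q(0) ∪ C where C is a connected subset of the Euclidean boundary of the Euclidean closure of B₁^q(0), and a homeomorphism from K onto K' (both sets carrying the subspace topology induced by the Euclidean topology of ℝ²). -/
open Set Pointwise

theorem tendsto_add_diag (x : ℝ × ℝ) (s : Set ℝ) :
    Filter.Tendsto (fun δ : ℝ => x + (δ, δ)) (nhdsWithin 0 s) (nhds x) := by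
  have h : Continuous fun δ : ℝ => x + (δ, δ) := by fun_prop
  have h0 : x + ((0 : ℝ), (0 : ℝ)) = x := by ext <;> simp
  exact (h0 ▸ h.tendsto 0).mono_left nhdsWithin_le_nhds

/-- The height at which the diagonal line `{(d + r, r)}` leaves the set `S`. -/
noncomputable def diagHeight (S : Set (ℝ × ℝ)) (d : ℝ) : ℝ :=
  sSup {r : ℝ | (d + r, r) ∈ S}

/-- A nonempty set, bounded above, containing every point strictly below one of its points. -/
structure IsStrictLower (S : Set (ℝ × ℝ)) : Prop where
  nonempty : S.Nonempty
  mem_of_lt : ∀ p ∈ S, ∀ x : ℝ × ℝ, x.1 < p.1 → x.2 < p.2 → x ∈ S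
  bdd : ∃ M, ∀ x ∈ S, x.2 ≤ M

namespace IsStrictLower

variable {S : Set (ℝ × ℝ)}

theorem le_diagHeight (hS : IsStrictLower S) {x : ℝ × ℝ} (hx : x ∈ S) :
    x.2 ≤ diagHeight S (x.1 - x.2) := by
  obtain ⟨M, hM⟩ := hS.bdd
  exact le_csSup ⟨M, fun r hr => hM _ hr⟩ (by simpa using hx)

theorem mem_of_lt_diagHeight (hS : IsStrictLower S) {x : ℝ × ℝ}
    (hx : x.2 < diagHeight S (x.1 - x.2)) : x ∈ S := by
  obtain ⟨p, hp⟩ := hS.nonempty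
  have hne : {r : ℝ | (x.1 - x.2 + r, r) ∈ S}.Nonempty := by
    refine ⟨min (p.1 - (x.1 - x.2)) p.2 - 1, hS.mem_of_lt p hp _ ?_ ?_⟩
    · linarith [min_le_left (p.1 - (x.1 - x.2)) p.2]
    · linarith [min_le_right (p.1 - (x.1 - x.2)) p.2]
  obtain ⟨r, hr, hxr⟩ := exists_lt_of_lt_csSup hne hx
  exact hS.mem_of_lt _ hr x (by dsimp only; linarith) hxr

theorem diagHeight_sub_le (hS : IsStrictLower S) (d e : ℝ) :
    diagHeight S d - max (e - d) 0 ≤ diagHeight S e := by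
  refine le_of_forall_lt fun r hr => ?_
  obtain ⟨r', h1, h2⟩ := exists_between hr
  obtain ⟨s, h3, h4⟩ := exists_between (show r' + max (e - d) 0 < diagHeight S d by linarith)
  have hs : (d + s, s) ∈ S := hS.mem_of_lt_diagHeight (by simpa using h4)
  have hr' : (e + r', r') ∈ S := hS.mem_of_lt _ hs _
    (by dsimp only; linarith [le_max_left (e - d) 0])
    (by dsimp only; linarith [le_max_right (e - d) 0])
  have := hS.le_diagHeight hr'
  simp only [add_sub_cancel_right] at this
  linarith

theorem antitone_diagHeight (hS : IsStrictLower S) : Antitone (diagHeight S) := fun e d h => by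
  simpa [max_eq_right (sub_nonpos.2 h)] using hS.diagHeight_sub_le d e

theorem monotone_add_diagHeight (hS : IsStrictLower S) :
    Monotone fun d => d + diagHeight S d := fun d e h => by
  have := hS.diagHeight_sub_le d e
  rw [max_eq_left (sub_nonneg.2 h)] at this
  dsimp only
  linarith

theorem continuous_diagHeight (hS : IsStrictLower S) : Continuous (diagHeight S) := by
  refine (LipschitzWith.of_le_add fun d e => ?_).continuous
  rw [dist_comm, Real.dist_eq]
  linarith [hS.diagHeight_sub_le d e, max_le (le_abs_self (e - d)) (abs_nonneg (e - d))]

theorem closure_eq (hS : IsStrictLower S) :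
    closure S = {x : ℝ × ℝ | x.2 ≤ diagHeight S (x.1 - x.2)} := by
  refine (closure_minimal (fun x hx => hS.le_diagHeight hx) (isClosed_le continuous_snd
    (hS.continuous_diagHeight.comp (continuous_fst.sub continuous_snd)))).antisymm fun x hx => ?_
  refine mem_closure_of_tendsto (tendsto_add_diag x (Iio 0)) ?_
  filter_upwards [self_mem_nhdsWithin] with δ hδ
  refine hS.mem_of_lt_diagHeight ?_
  have hδ : δ < 0 := hδ
  have hx : x.2 ≤ diagHeight S (x.1 - x.2) := hx
  simp only [Prod.fst_add, Prod.snd_add, add_sub_add_right_eq_sub]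
  linarith

theorem mem_frontier_closure (hS : IsStrictLower S) {x : ℝ × ℝ}
    (hx : x.2 = diagHeight S (x.1 - x.2)) : x ∈ frontier (closure S) := by
  rw [isClosed_closure.frontier_eq]
  refine ⟨by rw [hS.closure_eq]; exact hx.le, fun hint => ?_⟩
  obtain ⟨δ, hmem, hδ⟩ := (((tendsto_add_diag x (Ioi 0)).eventually_mem
    (mem_interior_iff_mem_nhds.1 hint)).and self_mem_nhdsWithin).exists
  rw [hS.closure_eq] at hmem
  have hδ : (0 : ℝ) < δ := hδ
  simp only [mem_ofPred_eq, Prod.fst_add, Prod.snd_add, add_sub_add_right_eq_sub] at hmem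
  linarith

theorem lt_diagHeight_of_isOpen (hS : IsStrictLower S) (ho : IsOpen S) {x : ℝ × ℝ}
    (hx : x ∈ S) : x.2 < diagHeight S (x.1 - x.2) := by
  refine (hS.le_diagHeight hx).lt_of_ne fun h => ?_
  have h2 := hS.mem_frontier_closure h
  rw [isClosed_closure.frontier_eq] at h2
  exact h2.2 (interior_mono subset_closure (ho.interior_eq.symm ▸ hx))

/-- Adding to an open convex strict lower set an arc of its boundary preserves convexity. -/
theorem convex_union_arc (hS : IsStrictLower S) (ho : IsOpen S) (hc : Convex ℝ S)
    {I : Set ℝ} (hI : I.OrdConnected) :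
    Convex ℝ (S ∪ {x | x.2 = diagHeight S (x.1 - x.2) ∧ x.1 - x.2 ∈ I}) := by
  have hcl : ∀ x ∈ S ∪ {x | x.2 = diagHeight S (x.1 - x.2) ∧ x.1 - x.2 ∈ I}, x ∈ closure S := by
    rintro x (hx | hx)
    · exact subset_closure hx
    · rw [hS.closure_eq]; exact hx.1.le
  rw [convex_iff_openSegment_subset]
  intro x hx y hy z hz
  rcases id hx with hxS | hxC
  · left
    have := hc.openSegment_interior_closure_subset_interior
      (ho.interior_eq.symm ▸ hxS) (hcl y hy) hz
    exact interior_subset this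
  rcases id hy with hyS | hyC
  · left
    have := hc.openSegment_closure_interior_subset_interior
      (hcl x hx) (ho.interior_eq.symm ▸ hyS) hz
    exact interior_subset this
  have hzcl := hc.closure.openSegment_subset (hcl x hx) (hcl y hy) hz
  rw [hS.closure_eq] at hzcl
  rcases lt_or_eq_of_le (show z.2 ≤ diagHeight S (z.1 - z.2) from hzcl) with h | h
  · exact Or.inl (hS.mem_of_lt_diagHeight h)
  · refine Or.inr ⟨h, ?_⟩
    obtain ⟨a, b, ha, hb, hab, rfl⟩ := hz
    have := hI.convex (𝕜 := ℝ) hxC.2 hyC.2 ha.le hb.le hab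
    convert this using 1
    simp only [Prod.fst_add, Prod.snd_add, Prod.smul_fst, Prod.smul_snd, smul_eq_mul]
    ring

end IsStrictLower

/-- Translation along the diagonal by an amount depending on the diagonal line. -/
def diagShear (g : ℝ → ℝ) (hg : Continuous g) : (ℝ × ℝ) ≃ₜ (ℝ × ℝ) where
  toFun x := (x.1 + g (x.1 - x.2), x.2 + g (x.1 - x.2))
  invFun x := (x.1 - g (x.1 - x.2), x.2 - g (x.1 - x.2))
  left_inv x := by simp
  right_inv x := by simp
  continuous_toFun := by fun_prop
  continuous_invFun := by fun_prop

theorem diagShear_apply (g : ℝ → ℝ) (hg : Continuous g) (x : ℝ × ℝ) :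
    diagShear g hg x = (x.1 + g (x.1 - x.2), x.2 + g (x.1 - x.2)) := rfl

/-- A convex set containing a quadrant contains every point strictly below one of its points. -/
theorem Convex.mem_of_lt_of_quadrant {K : Set (ℝ × ℝ)} (hK : Convex ℝ K) {c : ℝ × ℝ}
    (hc : ∀ y ≤ c, y ∈ K) {p x : ℝ × ℝ} (hp : p ∈ K) (h1 : x.1 < p.1) (h2 : x.2 < p.2) :
    x ∈ K := by
  obtain ⟨n, hn1⟩ := exists_nat_gt (max ((p.1 - c.1) / (p.1 - x.1)) ((p.2 - c.2) / (p.2 - x.2)))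
  obtain ⟨ha, hb⟩ := max_lt_iff.1 hn1
  rw [div_lt_iff₀ (by linarith)] at ha hb
  have hn : (0 : ℝ) < n + 1 := by positivity
  have hz : p - ((n : ℝ) + 1) • (p - x) ∈ K := by
    refine hc _ ⟨?_, ?_⟩ <;>
      simp only [Prod.fst_sub, Prod.snd_sub, Prod.smul_fst, Prod.smul_snd, smul_eq_mul] <;>
      nlinarith
  have := hK hp hz (a := 1 - 1 / ((n : ℝ) + 1)) (b := 1 / ((n : ℝ) + 1))
    (by rw [sub_nonneg, div_le_one hn]; linarith [n.cast_nonneg (α := ℝ)]) (by positivity) (by ring)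
  convert this using 1
  ext <;>
    simp only [Prod.fst_add, Prod.snd_add, Prod.fst_sub, Prod.snd_sub, Prod.smul_fst,
      Prod.smul_snd, smul_eq_mul] <;>
    field_simp <;> ring

section LatticeNorm

variable {N : ℝ × ℝ → ℝ}

theorem pos_of_lattice_norm (hN0 : ∀ x : ℝ × ℝ, N x = 0 ↔ x = 0)
    (hNl : ∀ x y : ℝ × ℝ, |x.1| ≤ |y.1| → |x.2| ≤ |y.2| → N x ≤ N y) {x : ℝ × ℝ} (hx : x ≠ 0) :
    0 < N x := by
  refine lt_of_le_of_ne ?_ fun h => hx ((hN0 x).1 h.symm)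
  rw [← (hN0 0).2 rfl]
  exact hNl 0 x (by simp) (by simp)

theorem q2_mono (hNl : ∀ x y : ℝ × ℝ, |x.1| ≤ |y.1| → |x.2| ≤ |y.2| → N x ≤ N y)
    {x y : ℝ × ℝ} (h : x ≤ y) : q2 N x ≤ q2 N y := by
  refine hNl _ _ ?_ ?_ <;> dsimp only <;>
    rw [abs_of_nonneg (le_max_right _ _), abs_of_nonneg (le_max_right _ _)]
  · exact max_le_max_right _ h.1
  · exact max_le_max_right _ h.2

theorem q2_add_le (hNt : ∀ x y : ℝ × ℝ, N (x + y) ≤ N x + N y)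
    (hNl : ∀ x y : ℝ × ℝ, |x.1| ≤ |y.1| → |x.2| ≤ |y.2| → N x ≤ N y) (x y : ℝ × ℝ) :
    q2 N (x + y) ≤ q2 N x + q2 N y := by
  refine le_trans (hNl _ _ ?_ ?_) (hNt _ _) <;>
    simp only [Prod.fst_add, Prod.snd_add] <;>
    rw [abs_of_nonneg (le_max_right _ _), abs_of_nonneg (by positivity)] <;>
    exact max_le (add_le_add (le_max_left _ _) (le_max_left _ _)) (by positivity)

theorem q2_smul (hNs : ∀ (c : ℝ) (x : ℝ × ℝ), N (c • x) = |c| * N x) {c : ℝ} (hc : 0 ≤ c)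
    (x : ℝ × ℝ) : q2 N (c • x) = c * q2 N x := by
  rw [q2, q2, ← abs_of_nonneg hc, ← hNs, abs_of_nonneg hc]
  congr 1
  ext <;> simp [mul_max_of_nonneg _ _ hc]

theorem exists_pos_q2_ball_bound (hN0 : ∀ x : ℝ × ℝ, N x = 0 ↔ x = 0)
    (hNs : ∀ (c : ℝ) (x : ℝ × ℝ), N (c • x) = |c| * N x)
    (hNl : ∀ x y : ℝ × ℝ, |x.1| ≤ |y.1| → |x.2| ≤ |y.2| → N x ≤ N y) :
    ∃ m > 0, ∀ δ > 0, ∀ x : ℝ × ℝ, q2 N x < m * δ → x ≤ (δ, δ) := by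
  have h1 : 0 < N (1, 0) := pos_of_lattice_norm hN0 hNl (by simp)
  have h2 : 0 < N (0, 1) := pos_of_lattice_norm hN0 hNl (by simp)
  refine ⟨min (N (1, 0)) (N (0, 1)), lt_min h1 h2, fun δ hδ x hx => ?_⟩
  by_contra hcon
  rw [Prod.le_def, not_and_or, not_le, not_le] at hcon
  refine hx.not_ge ?_
  rcases hcon with h | h
  · calc _ ≤ δ * N (1, 0) := by rw [mul_comm]; gcongr; exact min_le_left _ _
      _ = N (δ • (1, 0)) := by rw [hNs, abs_of_pos hδ]
      _ ≤ _ := by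
        refine hNl _ _ ?_ ?_
        · simpa [abs_of_pos hδ] using (h.le.trans (le_max_left x.1 0)).trans (le_abs_self _)
        · simp
  · calc _ ≤ δ * N (0, 1) := by rw [mul_comm]; gcongr; exact min_le_right _ _
      _ = N (δ • (0, 1)) := by rw [hNs, abs_of_pos hδ]
      _ ≤ _ := by
        refine hNl _ _ ?_ ?_
        · simp
        · simpa [abs_of_pos hδ] using (h.le.trans (le_max_left x.2 0)).trans (le_abs_self _)

theorem isOpen_q2_ball (hNs : ∀ (c : ℝ) (x : ℝ × ℝ), N (c • x) = |c| * N x)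
    (hNt : ∀ x y : ℝ × ℝ, N (x + y) ≤ N x + N y)
    (hNl : ∀ x y : ℝ × ℝ, |x.1| ≤ |y.1| → |x.2| ≤ |y.2| → N x ≤ N y) :
    IsOpen {y : ℝ × ℝ | q2 N y < 1} := by
  refine isOpen_iff_mem_nhds.2 fun x hx => ?_
  have hx : q2 N x < 1 := hx
  have hlim : Filter.Tendsto (fun δ : ℝ => q2 N x + δ * q2 N (1, 1)) (nhdsWithin 0 (Ioi 0))
      (nhds (q2 N x)) := by
    have : Continuous fun δ : ℝ => q2 N x + δ * q2 N (1, 1) := by fun_prop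
    exact (by simpa using this.tendsto 0 : Filter.Tendsto _ _ (nhds (q2 N x))).mono_left
      nhdsWithin_le_nhds
  obtain ⟨δ, h1, hδ⟩ := ((hlim.eventually (gt_mem_nhds hx)).and self_mem_nhdsWithin).exists
  have hδ : (0 : ℝ) < δ := hδ
  rw [← q2_smul hNs hδ.le] at h1
  have hnhds : Iio (x.1 + δ) ×ˢ Iio (x.2 + δ) ∈ nhds x :=
    prod_mem_nhds (Iio_mem_nhds (by linarith)) (Iio_mem_nhds (by linarith))
  filter_upwards [hnhds] with y hy
  refine lt_of_le_of_lt ((q2_mono hNl ?_).trans (q2_add_le hNt hNl x (δ • (1, 1)))) h1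
  exact ⟨by simpa using hy.1.le, by simpa using hy.2.le⟩

theorem convex_q2_ball (hNs : ∀ (c : ℝ) (x : ℝ × ℝ), N (c • x) = |c| * N x)
    (hNt : ∀ x y : ℝ × ℝ, N (x + y) ≤ N x + N y)
    (hNl : ∀ x y : ℝ × ℝ, |x.1| ≤ |y.1| → |x.2| ≤ |y.2| → N x ≤ N y) :
    Convex ℝ {y : ℝ × ℝ | q2 N y < 1} := by
  have : ConvexOn ℝ univ (q2 N) := by
    refine ⟨convex_univ, fun x _ y _ a b ha hb _ => ?_⟩
    rw [smul_eq_mul, smul_eq_mul, ← q2_smul hNs ha, ← q2_smul hNs hb]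
    exact q2_add_le hNt hNl _ _
  simpa using this.convex_lt 1

theorem isStrictLower_q2_ball (hN0 : ∀ x : ℝ × ℝ, N x = 0 ↔ x = 0)
    (hNs : ∀ (c : ℝ) (x : ℝ × ℝ), N (c • x) = |c| * N x)
    (hNl : ∀ x y : ℝ × ℝ, |x.1| ≤ |y.1| → |x.2| ≤ |y.2| → N x ≤ N y) :
    IsStrictLower {y : ℝ × ℝ | q2 N y < 1} := by
  refine ⟨⟨0, ?_⟩, fun p hp x h1 h2 => (q2_mono hNl ⟨h1.le, h2.le⟩).trans_lt hp, ?_⟩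
  · simp [q2, (hN0 (0, 0)).2 rfl]
  · obtain ⟨m, hm, hball⟩ := exists_pos_q2_ball_bound hN0 hNs hNl
    refine ⟨m⁻¹, fun x hx => (hball m⁻¹ (inv_pos.2 hm) x ?_).2⟩
    rwa [mul_inv_cancel₀ hm.ne']

/-- A monotone continuous function attains its maximum on a nonempty `q`-compact set. -/
theorem exists_isMaxOn_of_q2_compact (hN0 : ∀ x : ℝ × ℝ, N x = 0 ↔ x = 0)
    (hNs : ∀ (c : ℝ) (x : ℝ × ℝ), N (c • x) = |c| * N x)
    (hNl : ∀ x y : ℝ × ℝ, |x.1| ≤ |y.1| → |x.2| ≤ |y.2| → N x ≤ N y)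
    {K : Set (ℝ × ℝ)} (hne : K.Nonempty) (hcomp : @IsCompact _ (ballTop (q2 N)) K)
    {h : ℝ × ℝ → ℝ} (hmono : Monotone h) (hcont : Continuous h) :
    ∃ x ∈ K, IsMaxOn h K x := by
  obtain ⟨m, hm, hball⟩ := exists_pos_q2_ball_bound hN0 hNs hNl
  have hopen : ∀ a, @IsOpen _ (ballTop (q2 N)) (h ⁻¹' Iio a) := by
    intro a x hx
    have hlim := (hcont.tendsto x).comp (tendsto_add_diag x (Ioi 0))
    obtain ⟨δ, h1, hδ⟩ := ((hlim.eventually (gt_mem_nhds hx)).and self_mem_nhdsWithin).exists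
    refine ⟨m * δ, mul_pos hm hδ, fun y hy => (hmono ?_).trans_lt h1⟩
    exact sub_le_iff_le_add'.1 (hball δ hδ _ hy)
  let := ballTop (q2 N)
  have husc : UpperSemicontinuous h := upperSemicontinuous_iff_isOpen_preimage.2 hopen
  exact (husc.upperSemicontinuousOn K).exists_isMaxOn hne hcomp

end LatticeNorm

/-- Every `q`-compact convex body `K ⊆ ℝ²` is homeomorphic (in the Euclidean subspace
topologies) to a convex set `K′ = B₁^q(0) ∪ C` inside the Euclidean closure of `B₁^q(0)`,
where `C` is a connected subset of the Euclidean boundary of that closure. -/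
theorem body_homeomorphic_to_ball_union_arc
    (N : ℝ × ℝ → ℝ)
    (hN0 : ∀ x : ℝ × ℝ, N x = 0 ↔ x = 0)
    (hNs : ∀ (c : ℝ) (x : ℝ × ℝ), N (c • x) = |c| * N x)
    (hNt : ∀ x y : ℝ × ℝ, N (x + y) ≤ N x + N y)
    (hNl : ∀ x y : ℝ × ℝ, |x.1| ≤ |y.1| → |x.2| ≤ |y.2| → N x ≤ N y)
    (K : Set (ℝ × ℝ)) (hconv : Convex ℝ K)
    (hcomp : @IsCompact _ (ballTop (q2 N)) K)
    (hbody : (@interior _ (ballTop (q2 N)) K).Nonempty) :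
    ∃ K' C : Set (ℝ × ℝ),
      K' ⊆ closure {y : ℝ × ℝ | q2 N y < 1} ∧
      Convex ℝ K' ∧
      C ⊆ frontier (closure {y : ℝ × ℝ | q2 N y < 1}) ∧
      IsConnected C ∧
      K' = {y : ℝ × ℝ | q2 N y < 1} ∪ C ∧
      Nonempty (K ≃ₜ K') := by
  set B : Set (ℝ × ℝ) := {y | q2 N y < 1}
  have hB : IsStrictLower B := isStrictLower_q2_ball hN0 hNs hNl
  have hBo : IsOpen B := isOpen_q2_ball hNs hNt hNl
  have hBc : Convex ℝ B := convex_q2_ball hNs hNt hNl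
  obtain ⟨c, hc⟩ : ∃ c, ∀ y ≤ c, y ∈ K := by
    let := ballTop (q2 N)
    obtain ⟨c, hc⟩ := hbody
    obtain ⟨ε, hε, hsub⟩ := isOpen_interior (s := K) c hc
    refine ⟨c, fun y hy => interior_subset (hsub y ?_)⟩
    have h1 : y.1 - c.1 ≤ 0 := sub_nonpos.2 hy.1
    have h2 : y.2 - c.2 ≤ 0 := sub_nonpos.2 hy.2
    simpa [q2, max_eq_right h1, max_eq_right h2, (hN0 (0, 0)).2 rfl] using hε
  have hne : K.Nonempty := ⟨c, hc c le_rfl⟩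
  have hmax {h : ℝ × ℝ → ℝ} (hmono : Monotone h) (hcont : Continuous h) :
      ∃ x ∈ K, IsMaxOn h K x :=
    exists_isMaxOn_of_q2_compact hN0 hNs hNl hne hcomp hmono hcont
  have hK : IsStrictLower K := by
    refine ⟨hne, fun p hp x h1 h2 => hconv.mem_of_lt_of_quadrant hc hp h1 h2, ?_⟩
    obtain ⟨x, -, hx⟩ := hmax monotone_snd continuous_snd
    exact ⟨x.2, hx⟩
  set f := diagHeight K with hf
  set g := diagHeight B
  have hfc : Continuous f := hK.continuous_diagHeight
  have hgc : Continuous g := hB.continuous_diagHeight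
  set I : Set ℝ := {d | (d + f d, f d) ∈ K} with hIdef
  have hIne : I.Nonempty := by
    obtain ⟨x, hxK, hx⟩ := hmax (h := fun x => x.1 + x.2)
      (fun x y hxy => add_le_add hxy.1 hxy.2) (by fun_prop)
    have hfx : f (x.1 - x.2) = x.2 := by
      refine le_antisymm (le_of_forall_lt fun r hr => ?_) (hK.le_diagHeight hxK)
      by_contra! hcon
      obtain ⟨s, h1, h2⟩ := exists_between hr
      have hs : (x.1 - x.2 + s, s) ∈ K := hK.mem_of_lt_diagHeight (by simpa using h2)
      have : x.1 - x.2 + s + s ≤ x.1 + x.2 := hx hs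
      linarith
    exact ⟨x.1 - x.2, by simpa [hIdef, hfx] using hxK⟩
  have hdom (d : ℝ) : ∃ y ∈ K, (d + f d, f d) ≤ y := by
    obtain ⟨y, hyK, hy⟩ := hmax (h := fun x => min (x.1 - (d + f d)) (x.2 - f d))
      (fun x y hxy => min_le_min (sub_le_sub_right hxy.1 _) (sub_le_sub_right hxy.2 _))
      (by fun_prop)
    have h0 : 0 ≤ min (y.1 - (d + f d)) (y.2 - f d) := by
      refine le_of_forall_lt fun r hr => ?_
      obtain ⟨s, h1, h2⟩ := exists_between hr
      have hs : (d + (f d + s), f d + s) ∈ K :=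
        hK.mem_of_lt_diagHeight (by simpa [hf] using h2)
      have : min (d + (f d + s) - (d + f d)) (f d + s - f d) ≤ _ := hy hs
      rw [show d + (f d + s) - (d + f d) = s by ring, add_sub_cancel_left, min_self] at this
      exact h1.trans_le this
    rw [le_min_iff, sub_nonneg, sub_nonneg] at h0
    exact ⟨y, hyK, h0⟩
  have hline {x : ℝ × ℝ} {d : ℝ} (hx : x ∈ K) (hd : x.1 - x.2 = d) (hxd : f d ≤ x.2) :
      d ∈ I := by
    subst hd
    have h2 : f (x.1 - x.2) = x.2 := le_antisymm hxd (hK.le_diagHeight hx)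
    simpa [hIdef, h2] using hx
  have hseg {p y : ℝ × ℝ} {d : ℝ} (hp : p ∈ K) (hy : y ∈ K)
      (hd : d ∈ segment ℝ (p.1 - p.2) (y.1 - y.2))
      (h : (f d ≤ p.2 ∧ f d ≤ y.2) ∨ (d + f d ≤ p.1 ∧ d + f d ≤ y.1)) : d ∈ I := by
    obtain ⟨a, b, ha, hb, hab, hd⟩ := hd
    simp only [smul_eq_mul] at hd
    refine hline (hconv hp hy ha hb hab) ?_ ?_ <;>
      simp only [Prod.fst_add, Prod.snd_add, Prod.smul_fst, Prod.smul_snd, smul_eq_mul]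
    · linarith
    · rcases h with ⟨h1, h2⟩ | ⟨h1, h2⟩
      · have := add_le_add (mul_le_mul_of_nonneg_left h1 ha) (mul_le_mul_of_nonneg_left h2 hb)
        rwa [← add_mul, hab, one_mul] at this
      · have := add_le_add (mul_le_mul_of_nonneg_left h1 ha) (mul_le_mul_of_nonneg_left h2 hb)
        rw [← add_mul, hab, one_mul] at this
        linarith
  have hIord : I.OrdConnected := by
    refine ⟨fun d₁ hd₁ d₂ hd₂ d hd => ?_⟩
    obtain ⟨y, hyK, hy⟩ := hdom d
    rcases le_total d (y.1 - y.2) with h | h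
    · refine hseg hd₁ hyK ?_ (Or.inl ⟨hK.antitone_diagHeight hd.1, hy.2⟩)
      rw [add_sub_cancel_right, segment_eq_Icc (hd.1.trans h)]
      exact ⟨hd.1, h⟩
    · refine hseg hd₂ hyK ?_ (Or.inr ⟨hK.monotone_add_diagHeight hd.2, hy.1⟩)
      rw [add_sub_cancel_right, segment_symm, segment_eq_Icc (h.trans hd.2)]
      exact ⟨h, hd.2⟩
  set C : Set (ℝ × ℝ) := {x | x.2 = g (x.1 - x.2) ∧ x.1 - x.2 ∈ I} with hCdef
  have hCimg : C = (fun d => (d + g d, g d)) '' I := by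
    ext x
    constructor
    · rintro ⟨h1, h2⟩
      exact ⟨_, h2, by ext <;> simp [← h1]⟩
    · rintro ⟨d, hd, rfl⟩
      simpa [hCdef] using hd
  refine ⟨B ∪ C, C, union_subset subset_closure fun x hx => ?_, hB.convex_union_arc hBo hBc hIord,
    fun x hx => hB.mem_frontier_closure hx.1, ?_, rfl, ?_⟩
  · rw [hB.closure_eq]
    exact hx.1.le
  · rw [hCimg]
    exact ⟨hIne.image _, hIord.isPreconnected.image _ (by fun_prop)⟩
  · refine ⟨(diagShear (fun d => g d - f d) (hgc.sub hfc)).subtype fun x => ?_⟩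
    have hd : x.1 + (g (x.1 - x.2) - f (x.1 - x.2)) - (x.2 + (g (x.1 - x.2) - f (x.1 - x.2)))
      = x.1 - x.2 := by ring
    have hmemB : ∀ x, x ∈ B ↔ x.2 < g (x.1 - x.2) := fun x =>
      ⟨hB.lt_diagHeight_of_isOpen hBo, hB.mem_of_lt_diagHeight⟩
    simp only [diagShear_apply, mem_union, hmemB, hCdef,
      mem_ofPred_eq, hd]
    constructor
    · intro hx
      rcases lt_or_eq_of_le (show x.2 ≤ f (x.1 - x.2) from hK.le_diagHeight hx) with h | h
      · left; linarith
      · right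
        refine ⟨by linarith, ?_⟩
        exact hline hx rfl h.ge
    · rintro (h | ⟨h, hI⟩)
      · exact hK.mem_of_lt_diagHeight (show x.2 < f (x.1 - x.2) by linarith)
      · have hx2 : f (x.1 - x.2) = x.2 := by linarith
        simpa [hIdef, hx2] using hI
end

section
/- Let K ⊆ ℝ² be a q-compact convex body with α = u and β = v. Then K ⊆ (u,v) + θ₀, and (u,v) + θ₀ is contained in the Euclidean closure of K. -/
open Set Pointwise

/-- A compact nonempty set attains the maximum of a function with open strict sublevel sets. -/
lemma IsCompact.exists_forall_le_of_isOpen_lt {X : Type*} [TopologicalSpace X] {K : Set X}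
    (hK : IsCompact K) (hne : K.Nonempty) {f : X → ℝ} (hf : ∀ c, IsOpen {x | f x < c}) :
    ∃ x ∈ K, ∀ y ∈ K, f y ≤ f x :=
  ((upperSemicontinuous_iff_isOpen_preimage.2 hf).upperSemicontinuousOn K).exists_isMaxOn hne hK

/-- A functional whose positive increments are controlled by `q` has `q`-open strict sublevel
sets. -/
lemma isOpen_ballTop_lt {X : Type*} [Sub X] {q f : X → ℝ} {m : ℝ} (hm : 0 < m)
    (h : ∀ x y, (f y - f x) * m ≤ q (y - x)) (c : ℝ) :
    @IsOpen _ (ballTop q) {x | f x < c} := by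
  intro x hx
  refine ⟨(c - f x) * m, mul_pos (sub_pos.2 hx) hm, fun y hy => ?_⟩
  have := lt_of_mul_lt_mul_right ((h x y).trans_lt hy) hm.le
  simpa using this

lemma mem_theta0 {N : ℝ × ℝ → ℝ} (hN0 : ∀ x : ℝ × ℝ, N x = 0 ↔ x = 0) (x : ℝ × ℝ) :
    x ∈ theta0 N ↔ x.1 ≤ 0 ∧ x.2 ≤ 0 := by
  simp [theta0, q2, hN0, Prod.ext_iff]

/-- A direction of recession at one point of a convex set is one at every point of its closure. -/
lemma Convex.add_mem_closure_of_ray {E : Type*} [AddCommGroup E] [Module ℝ E]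
    [TopologicalSpace E] [IsTopologicalAddGroup E] [ContinuousSMul ℝ E] {K : Set E}
    (hK : Convex ℝ K) {p w t : E} (hray : ∀ r : ℝ, 0 < r → p + r • t ∈ K)
    (hw : w ∈ closure K) : w + t ∈ closure K := by
  have hc : Continuous fun s : ℝ => (1 - s) • w + s • p + t := by fun_prop
  have hlim : Filter.Tendsto (fun s : ℝ => (1 - s) • w + s • p + t) (nhdsWithin 0 (Ioo 0 1))
      (nhds (w + t)) := by
    simpa using (hc.tendsto 0).mono_left nhdsWithin_le_nhds
  have : (nhdsWithin (0 : ℝ) (Ioo 0 1)).NeBot :=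
    mem_closure_iff_nhdsWithin_neBot.1 (by simp [closure_Ioo])
  refine isClosed_closure.mem_of_tendsto hlim ?_
  filter_upwards [self_mem_nhdsWithin] with s hs
  have hmem := hK.closure hw (subset_closure (hray s⁻¹ (inv_pos.2 hs.1)))
    (sub_nonneg.2 hs.2.le) hs.1.le (sub_add_cancel 1 s)
  rwa [smul_add, smul_inv_smul₀ hs.1.ne', ← add_assoc] at hmem

/-- If `K ⊆ ℝ²` is a `q`-compact convex body with `α = u` and `β = v`, then
`K ⊆ (u,v) + θ₀` and `(u,v) + θ₀` is contained in the Euclidean closure of `K`. -/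
theorem body_between_translated_cone
    (N : ℝ × ℝ → ℝ)
    (hN0 : ∀ x : ℝ × ℝ, N x = 0 ↔ x = 0)
    (hNs : ∀ (c : ℝ) (x : ℝ × ℝ), N (c • x) = |c| * N x)
    (hNt : ∀ x y : ℝ × ℝ, N (x + y) ≤ N x + N y)
    (hNl : ∀ x y : ℝ × ℝ, |x.1| ≤ |y.1| → |x.2| ≤ |y.2| → N x ≤ N y)
    (K : Set (ℝ × ℝ)) (hconv : Convex ℝ K)
    (hcomp : @IsCompact _ (ballTop (q2 N)) K)
    (hbody : (@interior _ (ballTop (q2 N)) K).Nonempty)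
    (u v a b : ℝ)
    (hu : u = sSup (Prod.fst '' K)) (hv : v = sSup (Prod.snd '' K))
    (ha : a = sSup {x : ℝ | (x, v) ∈ K}) (hb : b = sSup {y : ℝ | (u, y) ∈ K})
    (hau : a = u) (hbv : b = v) :
    K ⊆ transl (u, v) (theta0 N) ∧ transl (u, v) (theta0 N) ⊆ closure K := by
  have hpos : ∀ e : ℝ × ℝ, e ≠ 0 → 0 < N e := fun e he => by
    have h1 := hNt e (-1 • e)
    have h2 := hNs (-1) e
    have h3 : N 0 = 0 := (hN0 0).2 rfl
    have h4 : N e ≠ 0 := fun h => he ((hN0 e).1 h)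
    norm_num [h3] at h1 h2
    exact lt_of_le_of_ne (by linarith) h4.symm
  have hmul : ∀ (r : ℝ) (e : ℝ × ℝ), e ≠ 0 → r * N e ≤ N (max r 0 • e) := fun r e he => by
    rw [hNs, abs_of_nonneg (le_max_right _ _)]
    exact mul_le_mul_of_nonneg_right (le_max_left _ _) (hpos e he).le
  have hne : K.Nonempty := hbody.mono (@interior_subset _ (ballTop (q2 N)) K)
  have hopen₁ := isOpen_ballTop_lt (q := q2 N) (f := Prod.fst) (hpos (1, 0) (by simp))
    fun x y => (hmul _ _ (by simp)).trans (hNl _ _ (by simp) (by simp))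
  have hopen₂ := isOpen_ballTop_lt (q := q2 N) (f := Prod.snd) (hpos (0, 1) (by simp))
    fun x y => (hmul _ _ (by simp)).trans (hNl _ _ (by simp) (by simp))
  obtain ⟨z, hzK, hz⟩ :=
    @IsCompact.exists_forall_le_of_isOpen_lt _ (ballTop (q2 N)) K hcomp hne _ hopen₁
  obtain ⟨w, hwK, hw⟩ :=
    @IsCompact.exists_forall_le_of_isOpen_lt _ (ballTop (q2 N)) K hcomp hne _ hopen₂
  have hzu : z.1 = u := by
    rw [hu]
    exact (IsGreatest.csSup_eq ⟨mem_image_of_mem _ hzK, forall_mem_image.2 hz⟩).symm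
  have hwv : w.2 = v := by
    rw [hv]
    exact (IsGreatest.csSup_eq ⟨mem_image_of_mem _ hwK, forall_mem_image.2 hw⟩).symm
  constructor
  · intro x hx
    refine ⟨x - (u, v), (mem_theta0 hN0 _).2 ⟨?_, ?_⟩, add_sub_cancel _ _⟩
    · simpa [← hzu] using hz x hx
    · simpa [← hwv] using hw x hx
  · have hcorner : (u, v) ∈ closure K := by
      have hmem : v ∈ closure {y : ℝ | (u, y) ∈ K} := by
        rw [← hbv, hb]
        exact csSup_mem_closure ⟨z.2, by simpa [← hzu] using hzK⟩ ⟨w.2, fun y hy => hw _ hy⟩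
      exact map_mem_closure (f := fun y : ℝ => (u, y)) (by fun_prop) hmem fun y hy => hy
    rintro _ ⟨t, ht, rfl⟩
    obtain ⟨p, hp⟩ := hbody
    obtain ⟨ε, hε, hball⟩ := @isOpen_interior _ (ballTop (q2 N)) K p hp
    refine hconv.add_mem_closure_of_ray (p := p) (fun r hr => ?_) hcorner
    refine @interior_subset _ (ballTop (q2 N)) K _ (hball _ ?_)
    have ht' := (mem_theta0 hN0 t).1 ht
    have : r • t ∈ theta0 N := (mem_theta0 hN0 _).2
      ⟨mul_nonpos_of_nonneg_of_nonpos hr.le ht'.1, mul_nonpos_of_nonneg_of_nonpos hr.le ht'.2⟩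
    rw [add_sub_cancel_left]
    exact (show q2 N (r • t) = 0 from this).trans_lt hε
end

section
/- For every point (x₀, y₀) ∈ ℝ², the set ((x₀, y₀) + int_q(θ₀)) ∪ {(x₀, y₀)} is q-compact. -/
open Set Pointwise

/-- A set is compact in the topology of `q` if it contains a point `a` such that
`q (y - a) = 0` for all of its points `y ≠ a`: every open set around `a` covers it. -/
theorem isCompact_ballTop_of_eq_zero {X : Type*} [Sub X] {q : X → ℝ} {S : Set X} {a : X}
    (ha : a ∈ S) (h : ∀ y ∈ S, y = a ∨ q (y - a) = 0) :
    @IsCompact _ (ballTop q) S := by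
  letI := ballTop q
  refine isCompact_of_finite_subcover fun {ι} U hU hS => ?_
  obtain ⟨i, hi⟩ := mem_iUnion.1 (hS ha)
  refine ⟨{i}, fun y hy => ?_⟩
  obtain ⟨ε, hε, hball⟩ := hU i a hi
  have hyU : y ∈ U i := by
    rcases h y hy with rfl | h0
    · exact hi
    · exact hball y (h0.trans_lt hε)
  simpa using hyU

/-- For every `(x₀,y₀) ∈ ℝ²`, the set `((x₀,y₀) + int_q θ₀) ∪ {(x₀,y₀)}` is `q`-compact. -/
theorem translated_open_cone_with_vertex_qCompact
    (N : ℝ × ℝ → ℝ)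
    (hN0 : ∀ x : ℝ × ℝ, N x = 0 ↔ x = 0)
    (hNs : ∀ (c : ℝ) (x : ℝ × ℝ), N (c • x) = |c| * N x)
    (hNt : ∀ x y : ℝ × ℝ, N (x + y) ≤ N x + N y)
    (hNl : ∀ x y : ℝ × ℝ, |x.1| ≤ |y.1| → |x.2| ≤ |y.2| → N x ≤ N y)
    (x₀ y₀ : ℝ) :
    @IsCompact _ (ballTop (q2 N))
      (transl (x₀, y₀) (thetaIntQ N) ∪ {((x₀, y₀) : ℝ × ℝ)}) := by
  refine isCompact_ballTop_of_eq_zero (a := (x₀, y₀)) (Or.inr rfl) ?_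
  rintro y (⟨z, hz, rfl⟩ | hy)
  · right
    have hz0 : q2 N z = 0 := @interior_subset _ (ballTop (q2 N)) _ z hz
    simpa using hz0
  · exact Or.inl hy
end

section
/- A set K ⊆ ℝⁿ is q-compact if and only if K + θ₀ is q-compact. -/
open Set Pointwise

/-- The asymmetric lattice norm on `ℝⁿ` induced by a lattice norm `N`: `q x = N (x ∨ 0)`. -/
def qn {n : ℕ} (N : (Fin n → ℝ) → ℝ) : (Fin n → ℝ) → ℝ :=
  fun x => N (fun i => max (x i) 0)

/-- Open sets of `ballTop q` absorb translations by vectors of zero `q`-size. -/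
lemma add_subset_iff_of_isOpen_ballTop {X : Type*} [AddCommGroup X] {q : X → ℝ} (h0 : q 0 = 0)
    (K : Set X) {U : Set X} (hU : @IsOpen _ (ballTop q) U) : K + {x | q x = 0} ⊆ U ↔ K ⊆ U := by
  refine ⟨fun h x hx => h ⟨x, hx, 0, h0, add_zero x⟩, ?_⟩
  rintro h _ ⟨x, hx, t, ht, rfl⟩
  obtain ⟨ε, hε, hball⟩ := hU x (h hx)
  refine hball _ ?_
  have ht' : q t = 0 := ht
  simpa [ht'] using hε

/-- Compactness depends only on which open sets contain the given set. -/
lemma isCompact_iff_of_subset_isOpen_iff {X : Type*} [TopologicalSpace X] {K L : Set X}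
    (h : ∀ U, IsOpen U → (K ⊆ U ↔ L ⊆ U)) : IsCompact K ↔ IsCompact L := by
  simp only [isCompact_iff_finite_subcover]
  refine forall₃_congr fun ι U hU => ?_
  rw [h _ (isOpen_iUnion hU)]
  refine imp_congr_right fun _ => exists_congr fun t => ?_
  exact h _ (isOpen_biUnion fun i _ => hU i)

/-- A set `K ⊆ ℝⁿ` is `q`-compact iff `K + θ₀` is `q`-compact. -/
theorem qCompact_iff_add_theta0_qCompact
    (n : ℕ) (N : (Fin n → ℝ) → ℝ)
    (hN0 : ∀ x : Fin n → ℝ, N x = 0 ↔ x = 0)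
    (hNs : ∀ (c : ℝ) (x : Fin n → ℝ), N (c • x) = |c| * N x)
    (hNt : ∀ x y : Fin n → ℝ, N (x + y) ≤ N x + N y)
    (hNl : ∀ x y : Fin n → ℝ, (∀ i, |x i| ≤ |y i|) → N x ≤ N y)
    (K : Set (Fin n → ℝ)) :
    @IsCompact _ (ballTop (qn N)) K ↔
      @IsCompact _ (ballTop (qn N)) (K + {x : Fin n → ℝ | qn N x = 0}) := by
  have h0 : qn N 0 = 0 := by
    rw [qn, hN0]
    ext i
    simp
  exact @isCompact_iff_of_subset_isOpen_iff _ (ballTop (qn N)) _ _ fun U hU =>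
    (add_subset_iff_of_isOpen_ballTop h0 K hU).symm
end

section
/- Every strongly q-compact subset of ℝⁿ is q-compact; in particular, every subset of ℝⁿ that is compact in the Euclidean topology is q-compact. -/
open Set Pointwise

/-- A monotone positively homogeneous function on `ℝⁿ` is dominated by the sup norm, so every
open set of `ballTop (qn N)` is open in the Euclidean topology. -/
lemma le_ballTop_qn {n : ℕ} {N : (Fin n → ℝ) → ℝ}
    (hNs : ∀ (c : ℝ) (x : Fin n → ℝ), N (c • x) = |c| * N x)
    (hNl : ∀ x y : Fin n → ℝ, (∀ i, |x i| ≤ |y i|) → N x ≤ N y) :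
    (inferInstance : TopologicalSpace (Fin n → ℝ)) ≤ ballTop (qn N) := by
  intro U hU
  refine Metric.isOpen_iff.2 fun x hx => ?_
  obtain ⟨ε, hε, h⟩ := hU x hx
  set C : ℝ := |N 1| + 1
  have hCpos : 0 < C := by positivity
  refine ⟨ε / C, div_pos hε hCpos, fun y hy => h y ?_⟩
  rw [Metric.mem_ball, dist_eq_norm, lt_div_iff₀ hCpos] at hy
  calc qn N (y - x) ≤ N (‖y - x‖ • 1) := hNl _ _ fun i => by
        have h_le : |(y - x) i| ≤ ‖y - x‖ := norm_le_pi_norm (y - x) i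
        simpa [abs_of_nonneg] using And.intro ((le_abs_self _).trans h_le) (norm_nonneg (y - x))
    _ = ‖y - x‖ * N 1 := by rw [hNs, abs_norm]
    _ ≤ ‖y - x‖ * C :=
        mul_le_mul_of_nonneg_left (by linarith [le_abs_self (N 1)]) (norm_nonneg _)
    _ < ε := hy

lemma isCompact_of_le_topology {X : Type*} {t₁ t₂ : TopologicalSpace X} (h : t₁ ≤ t₂) {K : Set X}
    (hK : @IsCompact X t₁ K) : @IsCompact X t₂ K := by
  simpa using @IsCompact.image X X t₁ t₂ K id hK (continuous_id_of_le h)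

/-- Open sets of `ballTop q` absorb `{z | q z = 0}`, so compactness passes from `K₀` to every
set between `K₀` and `K₀ + {z | q z = 0}`. -/
lemma isCompact_ballTop_of_subset_add {X : Type*} [AddCommGroup X] {q : X → ℝ} {K₀ K : Set X}
    (hK₀ : @IsCompact X (ballTop q) K₀) (h_sub : K₀ ⊆ K) (h_add : K ⊆ K₀ + {z | q z = 0}) :
    @IsCompact X (ballTop q) K := by
  let _ := ballTop q
  refine isCompact_of_finite_subcover fun {ι} U hUo hU => ?_
  obtain ⟨t, ht⟩ := hK₀.elim_finite_subcover U hUo (h_sub.trans hU)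
  refine ⟨t, fun y hy => ?_⟩
  obtain ⟨x, hx, z, hz, rfl⟩ := h_add hy
  obtain ⟨i, hi, hxi⟩ := Set.mem_iUnion₂.1 (ht hx)
  obtain ⟨ε, hε, hball⟩ := hUo i x hxi
  refine Set.mem_iUnion₂.2 ⟨i, hi, hball _ ?_⟩
  have h_zero : q z = 0 := hz
  rw [add_sub_cancel_left, h_zero]
  exact hε

/-- Every strongly `q`-compact subset of `ℝⁿ` is `q`-compact; in particular every
Euclidean-compact subset of `ℝⁿ` is `q`-compact. -/
theorem qCompact_of_strongly_qCompact
    (n : ℕ) (N : (Fin n → ℝ) → ℝ)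
    (hN0 : ∀ x : Fin n → ℝ, N x = 0 ↔ x = 0)
    (hNs : ∀ (c : ℝ) (x : Fin n → ℝ), N (c • x) = |c| * N x)
    (hNt : ∀ x y : Fin n → ℝ, N (x + y) ≤ N x + N y)
    (hNl : ∀ x y : Fin n → ℝ, (∀ i, |x i| ≤ |y i|) → N x ≤ N y)
    : (∀ K : Set (Fin n → ℝ),
        (∃ K₀ : Set (Fin n → ℝ), IsCompact K₀ ∧ K₀ ⊆ K ∧ K ⊆ K₀ + {x : Fin n → ℝ | qn N x = 0}) →
        @IsCompact _ (ballTop (qn N)) K) ∧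
      (∀ K : Set (Fin n → ℝ), IsCompact K → @IsCompact _ (ballTop (qn N)) K) := by
  have h_le := le_ballTop_qn hNs hNl
  refine ⟨?_, fun K hK => isCompact_of_le_topology h_le hK⟩
  rintro K ⟨K₀, hK₀, h_sub, h_add⟩
  exact isCompact_ballTop_of_subset_add (isCompact_of_le_topology h_le hK₀) h_sub h_add
end

section
/- In (ℝ³, q) with q(x) = max{x₁, x₂, x₃, 0}, let A := {(x₁, 0, x₃) : x₁² + x₃² = 1, 0 < x₁ ≤ 1, x₃ ≥ 0} and K := co(A ∪ {(0,0,0), (0,1,1)}). Then K is q-compact. -/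
open Set Pointwise

/-- The asymmetric lattice norm `q(x) = max {x₁, x₂, x₃, 0}` on `ℝ³`. -/
def q3 : (Fin 3 → ℝ) → ℝ := fun x => max (x 0) (max (x 1) (max (x 2) 0))

/-- The quarter circle `A = {(x₁, 0, x₃) : x₁² + x₃² = 1, 0 < x₁ ≤ 1, x₃ ≥ 0}`. -/
def A3 : Set (Fin 3 → ℝ) :=
  {x | x 1 = 0 ∧ (x 0) ^ 2 + (x 2) ^ 2 = 1 ∧ 0 < x 0 ∧ x 0 ≤ 1 ∧ 0 ≤ x 2}

/-- `K = co (A ∪ {(0,0,0), (0,1,1)})`. -/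
def K3 : Set (Fin 3 → ℝ) :=
  convexHull ℝ (A3 ∪ {![0, 0, 0], ![0, 1, 1]})

theorem q3_lt_iff {x : Fin 3 → ℝ} {ε : ℝ} (hε : 0 < ε) : q3 x < ε ↔ ∀ i, x i < ε := by
  simp [q3, Fin.forall_fin_succ, hε]

/-- A `q3`-open set is a lower set. -/
theorem isLowerSet_of_isOpen_ballTop_q3 {U : Set (Fin 3 → ℝ)} (hU : @IsOpen _ (ballTop q3) U) :
    IsLowerSet U := by
  intro x y hyx hx
  obtain ⟨ε, hε, h⟩ := hU x hx
  refine h y ((q3_lt_iff hε).2 fun i => ?_)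
  have := hyx i
  simp only [Pi.sub_apply]
  linarith

/-- A `q3`-open set is open in the usual topology. -/
theorem isOpen_of_isOpen_ballTop_q3 {U : Set (Fin 3 → ℝ)} (hU : @IsOpen _ (ballTop q3) U) :
    IsOpen U := by
  refine Metric.isOpen_iff.2 fun x hx => ?_
  obtain ⟨ε, hε, h⟩ := hU x hx
  refine ⟨ε, hε, fun y hy => h y ((q3_lt_iff hε).2 fun i => ?_)⟩
  exact (le_abs_self _).trans_lt ((dist_pi_lt_iff hε).1 hy i)

/-- A subset `K` of a compact set `C` such that every point of `C` lies below a point of `K` is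
`q3`-compact. -/
theorem isCompact_ballTop_q3_of_subset_lowerClosure {K C : Set (Fin 3 → ℝ)} (hC : IsCompact C)
    (hKC : K ⊆ C) (hCK : C ⊆ lowerClosure K) : @IsCompact _ (ballTop q3) K := by
  refine (@isCompact_iff_finite_subcover _ (ballTop q3) K).2 fun {ι} U hU hKU => ?_
  obtain ⟨t, ht⟩ := hC.elim_finite_subcover U (fun i => isOpen_of_isOpen_ballTop_q3 (hU i))
    fun x hx => by
      obtain ⟨k, hk, hxk⟩ := hCK hx
      obtain ⟨i, hi⟩ := mem_iUnion.1 (hKU hk)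
      exact mem_iUnion.2 ⟨i, isLowerSet_of_isOpen_ballTop_q3 (hU i) hxk hi⟩
  exact ⟨t, hKC.trans ht⟩

theorem Convex.lowerClosure_pi {ι : Type*} {K : Set (ι → ℝ)} (hK : Convex ℝ K) :
    Convex ℝ (lowerClosure K : Set (ι → ℝ)) := by
  rintro x ⟨k, hk, hxk⟩ y ⟨l, hl, hyl⟩ a b ha hb hab
  exact ⟨a • k + b • l, hK hk hl ha hb hab,
    add_le_add (smul_le_smul_of_nonneg_left hxk ha) (smul_le_smul_of_nonneg_left hyl hb)⟩

protected theorem IsCompact.convexJoin {E : Type*} [AddCommGroup E] [Module ℝ E] [TopologicalSpace E]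
    [ContinuousAdd E] [ContinuousSMul ℝ E] {s t : Set E} (hs : IsCompact s) (ht : IsCompact t) :
    IsCompact (convexJoin ℝ s t) := by
  have h : convexJoin ℝ s t = (fun p : ℝ × E × E => (1 - p.1) • p.2.1 + p.1 • p.2.2) ''
      (Icc (0 : ℝ) 1 ×ˢ s ×ˢ t) := by
    ext x
    simp only [mem_convexJoin, segment_eq_image, mem_image, mem_prod, Prod.exists]
    constructor
    · rintro ⟨a, ha, b, hb, r, hr, rfl⟩
      exact ⟨r, a, b, ⟨hr, ha, hb⟩, rfl⟩
    · rintro ⟨r, a, b, ⟨hr, ha, hb⟩, rfl⟩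
      exact ⟨a, ha, b, hb, r, hr, rfl⟩
  rw [h]
  exact (isCompact_Icc.prod (hs.prod ht)).image (by fun_prop)

/-- The closed quarter disk bounded by `A3` and the coordinate axes. -/
def quarterDisk3 : Set (Fin 3 → ℝ) :=
  {x | x 1 = 0 ∧ (x 0) ^ 2 + (x 2) ^ 2 ≤ 1 ∧ 0 ≤ x 0 ∧ 0 ≤ x 2}

theorem isCompact_quarterDisk3 : IsCompact quarterDisk3 := by
  have hclosed : IsClosed quarterDisk3 := by
    refine IsClosed.and (isClosed_eq ?_ ?_) ((isClosed_le ?_ ?_).and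
      ((isClosed_le ?_ ?_).and (isClosed_le ?_ ?_))) <;> fun_prop
  refine (isCompact_Icc (a := (0 : Fin 3 → ℝ)) (b := 1)).of_isClosed_subset hclosed ?_
  rintro x ⟨h1, h, h0, h2⟩
  constructor <;> intro i <;> fin_cases i <;> simp <;> nlinarith

theorem convex_quarterDisk3 : Convex ℝ quarterDisk3 := by
  rintro x ⟨hx1, hx, hx0, hx2⟩ y ⟨hy1, hy, hy0, hy2⟩ a b ha hb hab
  refine ⟨by simp [hx1, hy1], ?_, ?_, ?_⟩ <;> simp only [Pi.add_apply, Pi.smul_apply, smul_eq_mul]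
  · obtain rfl : b = 1 - a := by linarith
    nlinarith [mul_nonneg (mul_nonneg ha hb) (sq_nonneg (x 0 - y 0)),
      mul_nonneg (mul_nonneg ha hb) (sq_nonneg (x 2 - y 2)),
      mul_le_mul_of_nonneg_left hx ha, mul_le_mul_of_nonneg_left hy hb]
  · positivity
  · positivity

theorem quarterDisk3_subset_lowerClosure : quarterDisk3 ⊆ lowerClosure K3 := by
  rintro x ⟨h1, h, h0, h2⟩
  rcases (show x 2 ≤ 1 by nlinarith).eq_or_lt with h2' | h2'
  · refine ⟨![0, 1, 1], subset_convexHull ℝ _ (by simp), fun i => ?_⟩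
    fin_cases i <;> simp <;> nlinarith
  · have hpos : 0 < 1 - x 2 ^ 2 := by nlinarith
    refine ⟨![√(1 - x 2 ^ 2), 0, x 2], subset_convexHull ℝ _ (Or.inl
      ⟨by simp, by simp [Real.sq_sqrt hpos.le], by simpa using hpos, ?_, by simpa using h2⟩),
      fun i => ?_⟩
    · exact Real.sqrt_le_one.2 (by nlinarith)
    · fin_cases i
      · exact Real.le_sqrt_of_sq_le (le_sub_iff_add_le.2 h)
      · simp [h1]
      · simp

/-- The set `K = co (A ∪ {(0,0,0), (0,1,1)})` is `q`-compact in `(ℝ³, q)`. -/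
theorem K3_qCompact : @IsCompact _ (ballTop q3) K3 := by
  have hdisk : quarterDisk3.Nonempty := ⟨0, by simp [quarterDisk3]⟩
  refine isCompact_ballTop_q3_of_subset_lowerClosure
    (isCompact_quarterDisk3.convexJoin (isCompact_singleton (x := ![0, 1, 1])))
    (convexHull_min ?_ (convex_quarterDisk3.convexJoin (convex_singleton _))) ?_
  · rintro x (⟨h1, h, h0, -, h2⟩ | rfl | rfl)
    · exact subset_convexJoin_left (singleton_nonempty _) ⟨h1, h.le, h0.le, h2⟩
    · exact subset_convexJoin_left (singleton_nonempty _) (by simp [quarterDisk3])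
    · exact subset_convexJoin_right hdisk rfl
  · have hconv : Convex ℝ (lowerClosure K3 : Set (Fin 3 → ℝ)) :=
      (convex_convexHull ℝ _).lowerClosure_pi
    refine iUnion₂_subset fun x hx => iUnion₂_subset fun y hy => ?_
    refine hconv.segment_subset (quarterDisk3_subset_lowerClosure hx) (subset_lowerClosure ?_)
    exact subset_convexHull ℝ _ (Or.inr (Or.inr hy))
end
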